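/- Fix a purely imaginary parameter τ ∈ iℝ, set τ' = −τ and 𝒮 = 4|τ| + 1, and let φ̃ : ℝ → ℂ be the π-periodic function φ̃(c) = 1 + e^{2ic}. Then there exists a constant C > 0, depending only on τ, such that for every n ∈ 2ℤ and every λ ∈ iℝ the following two bounds hold: (II₁) if 𝒮 ≤ |λ| ≤ 4|n| then |F_{λ,n}(φ̃)|² ≤ C · (1 + |n|)^{−1} · |λ|^{−1} + C · |λ|^{−3}; (II₂) if |λ| ≥ max(𝒮, 4|n|) then |F_{λ,n}(φ̃)|² ≤ C · |λ|^{−3}. -/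

import Mathlib

open MeasureTheory Real

/-- `pw r z = r^z = exp(z · ln r)` for a real base `r > 0`. -/
noncomputable def pw (r : ℝ) (z : ℂ) : ℂ := Complex.exp (z * (Real.log r : ℂ))

/-- The kernel `K_{τ,τ',λ}(x,y,z)` of the model trilinear functional. -/
noncomputable def Kker (τ τ' lam : ℂ) (x y z : ℝ) : ℂ :=
  pw |Real.sin (x - y)| ((-τ - τ' + lam - 1) / 2) *
    pw |Real.sin (x - z)| ((-τ + τ' - lam - 1) / 2) *
    pw |Real.sin (y - z)| ((τ - τ' - lam - 1) / 2)

/-- `l_λ(c) = (1/2π) ∫₀^{2π} K_{τ,τ',λ}(y+c, y, 0) dy`. -/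
noncomputable def lker (τ τ' lam : ℂ) (c : ℝ) : ℂ :=
  (1 / (2 * (π : ℂ))) * ∫ y in (0 : ℝ)..(2 * π), Kker τ τ' lam (y + c) y 0

/-- `F_{λ,n}(φ) = ∫₀^{2π} l_λ(c) e^{inc} φ(c) dc`. -/
noncomputable def Ffun (τ τ' lam : ℂ) (n : ℤ) (φ : ℝ → ℂ) : ℂ :=
  ∫ c in (0 : ℝ)..(2 * π),
    lker τ τ' lam c * Complex.exp (Complex.I * (n : ℂ) * (c : ℂ)) * φ c

/-- `k_λ(c) = |sin c|^{(-τ-τ'-1)/2} |sin(c/2)|^{-λ/2} |cos(c/2)|^{λ/2}`. -/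
noncomputable def kfun (τ τ' lam : ℂ) (c : ℝ) : ℂ :=
  pw |Real.sin c| ((-τ - τ' - 1) / 2) * pw |Real.sin (c / 2)| (-lam / 2) *
    pw |Real.cos (c / 2)| (lam / 2)

/-- `G_{λ,n}(φ) = 2 ∫₀^π k_λ(c) e^{inc} φ(c) dc`. -/
noncomputable def Gfun (τ τ' lam : ℂ) (n : ℤ) (φ : ℝ → ℂ) : ℂ :=
  2 * ∫ c in (0 : ℝ)..π,
    kfun τ τ' lam c * Complex.exp (Complex.I * (n : ℂ) * (c : ℂ)) * φ c

/-- Global `C^N`-norm of `φ`. -/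
noncomputable def Cnorm (N : ℕ) (φ : ℝ → ℂ) : ℝ :=
  ⨆ (m : Fin (N + 1)) (x : ℝ), ‖iteratedDeriv (m : ℕ) φ x‖

/-- Real solutions of the three-term recurrence -/
structure IsSol (t s : ℝ) (P f : ℕ → ℝ) : Prop where
  weight : ∀ k : ℕ, P k = (2 * k + 1) ^ 2 + t ^ 2
  zero : 2 * P 0 * (f 1 - f 0) = -(1 + s ^ 2) * f 0
  succ : ∀ k : ℕ, P (k + 1) * (f (k + 2) - f (k + 1)) - P k * (f (k + 1) - f k) =
    -(1 + s ^ 2) * f (k + 1)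

namespace IsSol

variable {t s : ℝ} {P f : ℕ → ℝ}

lemma weight_pos (h : IsSol t s P f) (k : ℕ) : 0 < P k := by
  rw [h.weight]; positivity

lemma sq_le_of_large (hs : 100 * (1 + |t|) ≤ s) : 10000 * (1 + t ^ 2) ≤ s ^ 2 := by
  have := abs_nonneg t
  have h2 := sq_abs t
  nlinarith

lemma two_mul_abs_le (h : IsSol t s P f) (hs : 100 * (1 + |t|) ≤ s) (k : ℕ) (hk : 6 * (k : ℝ) ≤ s) :
    2 * |f k| ≤ |f (k + 1)| := by
  have ht := sq_le_of_large hs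
  have hs0 : 100 ≤ s := by have := abs_nonneg t; linarith
  induction k with
  | zero =>
    have h0 := h.zero
    have hP := h.weight 0
    have hpos := h.weight_pos 0
    have e : 2 * P 0 * f 1 = -((1 + s ^ 2 - 2 * P 0) * f 0) := by linarith
    have e2 := congrArg abs e
    have hP' : P 0 = 1 + t ^ 2 := by rw [hP]; norm_num
    rw [abs_neg, abs_mul _ (f 1), abs_mul _ (f 0), abs_of_pos (by positivity : 0 < 2 * P 0),
      abs_of_nonneg (by nlinarith : 0 ≤ 1 + s ^ 2 - 2 * P 0)] at e2
    have : 2 * P 0 * (2 * |f 0|) ≤ 2 * P 0 * |f 1| := by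
      rw [e2]
      nlinarith [abs_nonneg (f 0)]
    exact le_of_mul_le_mul_left this (by positivity)
  | succ k ih =>
    push_cast at hk
    have ih := ih (by linarith)
    have h1 := h.succ k
    have hp1 := h.weight_pos (k + 1)
    have hp0 := h.weight_pos k
    have e : P (k + 1) * f (k + 2) + P k * f k = -((1 + s ^ 2 - P (k + 1) - P k) * f (k + 1)) := by
      linarith
    have hw : 3 * P (k + 1) + 2 * P k ≤ 1 + s ^ 2 := by
      rw [h.weight, h.weight]; push_cast
      have : (k : ℝ) + 1 ≤ s / 6 := by linarith
      have hk0 : (0 : ℝ) ≤ k := by positivity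
      nlinarith
    have e2 := congrArg abs e
    rw [abs_neg, abs_mul _ (f (k + 1)), abs_of_nonneg (by linarith : 0 ≤ 1 + s ^ 2 - P (k + 1) - P k)]
      at e2
    have e3 : |P (k + 1) * f (k + 2) + P k * f k| ≤ P (k + 1) * |f (k + 2)| + P k * |f k| := by
      refine (abs_add_le _ _).trans ?_
      rw [abs_mul, abs_mul, abs_of_pos hp1, abs_of_pos hp0]
    have e4 : P k * |f k| ≤ P k * |f (k + 1)| :=
      mul_le_mul_of_nonneg_left (by linarith [abs_nonneg (f k)]) hp0.le
    have e5 : (2 * P (k + 1) + P k) * |f (k + 1)| ≤ (1 + s ^ 2 - P (k + 1) - P k) * |f (k + 1)| :=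
      mul_le_mul_of_nonneg_right (by linarith) (abs_nonneg _)
    have : P (k + 1) * (2 * |f (k + 1)|) ≤ P (k + 1) * |f (k + 2)| := by nlinarith
    exact le_of_mul_le_mul_left this hp1

lemma two_pow_mul_abs_le (h : IsSol t s P f) (hs : 100 * (1 + |t|) ≤ s) (j k : ℕ)
    (hk : 6 * ((k : ℝ) + j) ≤ s + 6) : 2 ^ j * |f k| ≤ |f (k + j)| := by
  induction j with
  | zero => simp
  | succ j ih =>
    push_cast at hk
    have h1 := ih (by linarith)
    have h2 := h.two_mul_abs_le hs (k + j) (by push_cast; linarith)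
    rw [pow_succ, ← add_assoc]
    linarith

lemma succ_cube_le (j : ℕ) : ((j : ℝ) + 1) ^ 3 ≤ 2 * 4 ^ j := by
  induction j with
  | zero => norm_num
  | succ j ih =>
    push_cast
    rcases Nat.eq_zero_or_pos j with rfl | hj
    · norm_num
    · have hj1 : (1 : ℝ) ≤ j := by exact_mod_cast hj
      have := pow_le_pow_left₀ (by positivity) (by linarith : (j : ℝ) + 1 + 1 ≤ 3 / 2 * (j + 1)) 3
      rw [mul_pow] at this
      rw [pow_succ (4 : ℝ) j]
      linarith [(by positivity : (0 : ℝ) ≤ ((j : ℝ) + 1) ^ 3)]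

/-- Decay in the classically forbidden region. -/
lemma sq_add_le_of_small (h : IsSol t s P f) (hs : 100 * (1 + |t|) ≤ s) {M : ℝ}
    (hM : ∀ k, |f k| ≤ M) (k : ℕ) (hk : 8 * (k : ℝ) ≤ s) :
    (f k + f (k + 1)) ^ 2 ≤ 8 * 24 ^ 3 * M ^ 2 * (1 / s ^ 3) := by
  have hs0 : 100 ≤ s := by have := abs_nonneg t; linarith
  have hM0 : 0 ≤ M := (abs_nonneg _).trans (hM 0)
  set j := ⌊s / 24⌋₊ with hj
  have hj1 : (j : ℝ) ≤ s / 24 := Nat.floor_le (by positivity)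
  have hj2 : s / 24 < j + 1 := Nat.lt_floor_add_one _
  have h1 := (h.two_pow_mul_abs_le hs j k (by linarith)).trans (hM _)
  have h2 := (h.two_pow_mul_abs_le hs j (k + 1) (by push_cast; linarith)).trans (hM _)
  have h3 : 2 ^ j * |f k + f (k + 1)| ≤ 2 * M := by
    have := mul_le_mul_of_nonneg_left (abs_add_le (f k) (f (k + 1))) (by positivity : (0 : ℝ) ≤ 2 ^ j)
    linarith
  have h4 : (4 : ℝ) ^ j * (f k + f (k + 1)) ^ 2 ≤ 4 * M ^ 2 := by
    have := pow_le_pow_left₀ (by positivity) h3 2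
    rw [mul_pow, sq_abs, ← pow_mul, mul_comm j 2, pow_mul] at this
    norm_num at this
    linarith
  have h5 : s ^ 3 ≤ 24 ^ 3 * (2 * 4 ^ j) := by
    have : s ^ 3 ≤ (24 * ((j : ℝ) + 1)) ^ 3 := pow_le_pow_left₀ (by linarith) (by linarith) 3
    rw [mul_pow] at this
    linarith [succ_cube_le j]
  rw [mul_one_div, le_div_iff₀ (by positivity)]
  nlinarith [mul_le_mul_of_nonneg_left h5 (sq_nonneg (f k + f (k + 1)))]

/-- A good starting index at the scale `s`. -/
lemma exists_start (h : IsSol t s P f) (hs : 100 * (1 + |t|) ≤ s) {M : ℝ}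
    (hS : ∀ N : ℕ, ∑ k ∈ Finset.range N, (f (k + 2) - 2 * f (k + 1) + f k) ^ 2 ≤ M / s) :
    ∃ k : ℕ, s ≤ 2 * k ∧ (k : ℝ) ≤ s ∧ f k ^ 2 ≤ 3200 * M / s ^ 2 ∧
      (f (k + 1) - f k) ^ 2 ≤ 3200 * M / s ^ 2 := by
  have ht := sq_le_of_large hs
  have hs0 : 100 ≤ s := by have := abs_nonneg t; linarith
  set S : ℕ → ℝ := fun k => f (k + 2) - 2 * f (k + 1) + f k with hSdef
  set K := ⌈s / 2⌉₊ with hK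
  set L := ⌊s / 4⌋₊ with hL
  have hK1 : s / 2 ≤ K := Nat.le_ceil _
  have hK2 : (K : ℝ) < s / 2 + 1 := Nat.ceil_lt_add_one (by positivity)
  have hL1 : (L : ℝ) ≤ s / 4 := Nat.floor_le (by positivity)
  have hL2 : s / 4 < L + 1 := Nat.lt_floor_add_one _
  have hsum : ∀ a : ℕ, ∑ i ∈ Finset.range L, S (a + i) ^ 2 ≤ M / s := by
    intro a
    refine le_trans ?_ (hS (a + L))
    rw [Finset.sum_range_add]
    exact le_add_of_nonneg_left (Finset.sum_nonneg fun _ _ => sq_nonneg _)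
  obtain ⟨i, hi, hle⟩ : ∃ i ∈ Finset.range L,
      S (K + i) ^ 2 + S (K + 1 + i) ^ 2 ≤ (2 * M / s) / L := by
    apply Finset.exists_le_of_sum_le
    · exact ⟨0, Finset.mem_range.2 (by
        have : (0:ℝ) < L := by linarith
        exact_mod_cast this)⟩
    · rw [Finset.sum_add_distrib, Finset.sum_const, Finset.card_range, nsmul_eq_mul]
      have hL0 : (L : ℝ) ≠ 0 := by intro h0; rw [h0] at hL2; linarith
      rw [mul_div_cancel₀ _ hL0]
      have := hsum K
      have := hsum (K + 1)
      have e : 2 * M / s = M / s + M / s := by ring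
      linarith
  have hM0 : 0 ≤ M := by
    have := hS 0
    simp only [Finset.range_zero, Finset.sum_empty] at this
    have h2 := mul_nonneg this (by linarith : 0 ≤ s)
    rwa [div_mul_cancel₀ _ (by linarith : s ≠ 0)] at h2
  have hiL : (i : ℝ) + 1 ≤ L := by exact_mod_cast Finset.mem_range.1 hi
  set j := K + i with hj
  have hjr : (j : ℝ) = K + i := by rw [hj]; push_cast; rfl
  have hS1 : S j ^ 2 + S (j + 1) ^ 2 ≤ 16 * M / s ^ 2 := by
    have e : K + 1 + i = j + 1 := by omega
    rw [e] at hle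
    refine hle.trans ?_
    have hL8 : s / 8 ≤ L := by linarith
    have hLp : (0 : ℝ) < L := by linarith
    rw [div_div, div_le_div_iff₀ (by positivity) (by positivity)]
    have : s ^ 2 ≤ 8 * (s * L) := by nlinarith
    nlinarith [mul_le_mul_of_nonneg_left this hM0]
  have r1 := h.succ j
  have r2 := h.succ (j + 1)
  have w0 := h.weight j
  have w1 := h.weight (j + 1)
  have w2 := h.weight (j + 2)
  push_cast at w0 w1 w2
  have eD : (s ^ 2 + 9) * (f (j + 2) - f (j + 1)) =
      (P (j + 1) - 8 * (j + 1)) * S j - P (j + 2) * S (j + 1) := by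
    simp only [hSdef]
    rw [w0, w1] at r1
    rw [w1, w2] at r2
    rw [w1, w2]
    linear_combination r2 - r1
  have eF : (s ^ 2 + 1) * f (j + 1) =
      - (P (j + 1) - 8 * (j + 1)) * S j - 8 * (j + 1) * (f (j + 2) - f (j + 1)) := by
    simp only [hSdef]
    rw [w0, w1] at r1
    rw [w1]
    linear_combination r1
  have hjs : (j : ℝ) + 2 ≤ s := by linarith
  have hj0 : (0 : ℝ) ≤ j := by positivity
  have b1 : |P (j + 1) - 8 * (j + 1)| ≤ 5 * s ^ 2 := by
    have : (2 * ((j : ℝ) + 1) + 1) ^ 2 ≤ (2 * s) ^ 2 :=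
      pow_le_pow_left₀ (by positivity) (by linarith) 2
    have h0 : 0 ≤ (2 * ((j : ℝ) + 1) + 1) ^ 2 + t ^ 2 := by positivity
    rw [w1, abs_le]; constructor <;> nlinarith only [this, h0, ht, hjs, hj0, hs0]
  have b2 : |P (j + 2)| ≤ 5 * s ^ 2 := by
    have : (2 * ((j : ℝ) + 2) + 1) ^ 2 ≤ (2 * s + 1) ^ 2 :=
      pow_le_pow_left₀ (by positivity) (by linarith) 2
    have h0 : 0 ≤ (2 * ((j : ℝ) + 2) + 1) ^ 2 + t ^ 2 := by positivity
    rw [w2, abs_le]; constructor <;> nlinarith only [this, h0, ht, hjs, hj0, hs0]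
  have b3 : |8 * ((j : ℝ) + 1)| ≤ 8 * s := by
    rw [abs_le]; constructor <;> linarith
  have hD : |f (j + 2) - f (j + 1)| ≤ 5 * (|S j| + |S (j + 1)|) := by
    have e := congrArg abs eD
    rw [abs_mul, abs_of_pos (by positivity : 0 < s ^ 2 + 9)] at e
    have e2 := abs_sub ((P (j + 1) - 8 * (j + 1)) * S j) (P (j + 2) * S (j + 1))
    rw [abs_mul, abs_mul] at e2
    have e3 := mul_le_mul_of_nonneg_right b1 (abs_nonneg (S j))
    have e4 := mul_le_mul_of_nonneg_right b2 (abs_nonneg (S (j + 1)))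
    have : s ^ 2 * |f (j + 2) - f (j + 1)| ≤ s ^ 2 * (5 * (|S j| + |S (j + 1)|)) := by
      linarith [abs_nonneg (f (j + 2) - f (j + 1))]
    exact le_of_mul_le_mul_left this (by positivity)
  have hF : |f (j + 1)| ≤ 10 * (|S j| + |S (j + 1)|) := by
    have e := congrArg abs eF
    rw [abs_mul, abs_of_pos (by positivity : 0 < s ^ 2 + 1)] at e
    have e2 := abs_sub (-(P (j + 1) - 8 * (j + 1)) * S j) (8 * (j + 1) * (f (j + 2) - f (j + 1)))
    rw [abs_mul, abs_mul, abs_neg] at e2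
    have e3 := mul_le_mul_of_nonneg_right b1 (abs_nonneg (S j))
    have e4 := mul_le_mul_of_nonneg_right b3 (abs_nonneg (f (j + 2) - f (j + 1)))
    have e5 := mul_le_mul_of_nonneg_left hD (by linarith : 0 ≤ 8 * s)
    have : s ^ 2 * |f (j + 1)| ≤ s ^ 2 * (10 * (|S j| + |S (j + 1)|)) := by
      have e6 : s * (|S j| + |S (j + 1)|) * 100 ≤ s * (|S j| + |S (j + 1)|) * s :=
        mul_le_mul_of_nonneg_left hs0 (by positivity)
      have e7 : 0 ≤ s ^ 2 * |S (j + 1)| := by positivity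
      have e8 : 0 ≤ s ^ 2 * |S j| := by positivity
      linarith [abs_nonneg (f (j + 1))]
    exact le_of_mul_le_mul_left this (by positivity)
  have hsq : ∀ x : ℝ, |x| ≤ 10 * (|S j| + |S (j + 1)|) → x ^ 2 ≤ 3200 * M / s ^ 2 := by
    intro x hx
    have h1 := pow_le_pow_left₀ (abs_nonneg x) hx 2
    rw [sq_abs] at h1
    have h2 : (10 * (|S j| + |S (j + 1)|)) ^ 2 ≤ 200 * (S j ^ 2 + S (j + 1) ^ 2) := by
      rw [← sq_abs (S j), ← sq_abs (S (j + 1))]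
      linarith [sq_nonneg (|S j| - |S (j + 1)|)]
    have h4 : 3200 * M / s ^ 2 = 200 * (16 * M / s ^ 2) := by ring
    linarith
  refine ⟨j + 1, ?_, ?_, hsq _ hF, hsq _ (hD.trans ?_)⟩
  · push_cast; linarith
  · push_cast; linarith
  · linarith [abs_nonneg (S j), abs_nonneg (S (j + 1))]

/-- Discrete form of the conserved energy of the Euler equation `(n² F')' + (e / 4) F = 0`. -/
noncomputable def eulerEnergy (e n w y : ℝ) : ℝ :=
  w ^ 2 / n + (2 + e / n) * (w * y) + e * (n + 1) * y ^ 2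

lemma le_eulerEnergy {e n w y : ℝ} (hs0 : 100 ≤ s) (he : e = 1 + s ^ 2) (hn : s ≤ n) :
    (w ^ 2 / n + e * n * y ^ 2) / 4 ≤ eulerEnergy e n w y := by
  have hn0 : 0 < n := by linarith
  have h1 : e / n ≤ s + 1 := by
    rw [div_le_iff₀ hn0, he]; nlinarith
  have h0 : 0 ≤ e / n := by rw [he]; positivity
  have h2 : (2 + e / n) ^ 2 ≤ (9 / 4) * e := by
    have := pow_le_pow_left₀ (by positivity) (by linarith : 2 + e / n ≤ s + 3) 2
    have h5 : (s + 3) ^ 2 ≤ (9 / 4) * e := by rw [he]; nlinarith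
    linarith
  have h3 : 0 ≤ (3 / 4 * (w / n) + (2 + e / n) / 2 * y) ^ 2 := sq_nonneg _
  have h4 : 0 ≤ ((9 / 4) * e - (2 + e / n) ^ 2) * y ^ 2 := mul_nonneg (by linarith) (sq_nonneg _)
  have he0 : 0 ≤ e := by rw [he]; positivity
  have key : eulerEnergy e n w y - (w ^ 2 / n + e * n * y ^ 2) / 4 =
      n * (4 / 3) * (3 / 4 * (w / n) + (2 + e / n) / 2 * y) ^ 2 +
      n / 3 * (((9 / 4) * e - (2 + e / n) ^ 2) * y ^ 2) + e * y ^ 2 := by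
    unfold eulerEnergy
    field_simp
    ring
  have : 0 ≤ eulerEnergy e n w y - (w ^ 2 / n + e * n * y ^ 2) / 4 := by
    rw [key]; positivity
  linarith

lemma eulerEnergy_sub {e x p w y : ℝ} (hx1 : x - 1 ≠ 0) (hx2 : x + 1 ≠ 0)
    (hp0 : p ≠ 0) (hp : p = x ^ 2 + t ^ 2) :
    eulerEnergy e (x + 1) (w - e * (y + w / p)) (y + w / p) - eulerEnergy e (x - 1) w y =
      (-2 * (1 + t ^ 2) / (p * (x ^ 2 - 1)) + e * (x - t ^ 2) / (p ^ 2 * (x + 1))) * w ^ 2 +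
      (-(2 * e * x * (1 + t ^ 2) / (p * (x ^ 2 - 1)))) * (w * y) := by
  have e1 : x ^ 2 - 1 = (x - 1) * (x + 1) := by ring
  have ht2 : t ^ 2 = p - x ^ 2 := by rw [hp]; ring
  unfold eulerEnergy
  rw [ht2, e1]
  field_simp
  ring

lemma mul_bounds_of_sum {e a w y Q : ℝ} (he : 10000 ≤ e) (ha : 0 < a)
    (hQ : Q = w ^ 2 / a + e * a * y ^ 2) : w ^ 2 ≤ a * Q ∧ |w * y| ≤ Q / 200 := by
  have he0 : 0 < e := by linarith
  have hQ0 : 0 ≤ Q := by rw [hQ]; positivity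
  constructor
  · have h1 : w ^ 2 / a ≤ Q := by
      rw [hQ]; exact le_add_of_nonneg_right (by positivity)
    rwa [div_le_iff₀' ha] at h1
  · have h4 : Q ^ 2 = (w ^ 2 / a - e * a * y ^ 2) ^ 2 + 4 * e * (w * y) ^ 2 := by
      rw [hQ]; field_simp; ring
    have h5 : 10000 * (w * y) ^ 2 ≤ e * (w * y) ^ 2 :=
      mul_le_mul_of_nonneg_right he (sq_nonneg _)
    have h3 : (200 * |w * y|) ^ 2 ≤ Q ^ 2 := by
      rw [mul_pow, sq_abs]
      linarith [sq_nonneg (w ^ 2 / a - e * a * y ^ 2)]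
    have := abs_le_of_sq_le_sq' h3 hQ0
    linarith [this.2]

lemma eulerEnergy_coeff_le {e x p : ℝ} (hx : 2 ≤ x) (he0 : 0 < e) (hp : p = x ^ 2 + t ^ 2) :
    -2 * (1 + t ^ 2) / (p * (x ^ 2 - 1)) + e * (x - t ^ 2) / (p ^ 2 * (x + 1)) ≤ e / x ^ 4 ∧
      2 * e * x * (1 + t ^ 2) / (p * (x ^ 2 - 1)) ≤ 4 * e * (1 + t ^ 2) / x ^ 3 := by
  have hx0 : 0 < x := by linarith
  have hp0 : 0 < p := by rw [hp]; positivity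
  have hpx : x ^ 2 ≤ p := by rw [hp]; linarith [sq_nonneg t]
  have hx21 : 0 < x ^ 2 - 1 := by nlinarith
  constructor
  · have a1 : -2 * (1 + t ^ 2) / (p * (x ^ 2 - 1)) ≤ 0 :=
      div_nonpos_of_nonpos_of_nonneg (by linarith [sq_nonneg t]) (by positivity)
    have a2 : e * (x - t ^ 2) / (p ^ 2 * (x + 1)) ≤ e / x ^ 4 := by
      rw [div_le_div_iff₀ (by positivity) (by positivity)]
      have b1 : x ^ 4 ≤ p ^ 2 := by
        have := pow_le_pow_left₀ (by positivity) hpx 2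
        rwa [← pow_mul] at this
      have b2 : (x - t ^ 2) * x ^ 4 ≤ (x + 1) * p ^ 2 :=
        mul_le_mul (by linarith [sq_nonneg t]) b1 (by positivity) (by linarith)
      have := mul_le_mul_of_nonneg_left b2 he0.le
      linarith
    linarith
  · rw [div_le_div_iff₀ (by positivity) (by positivity)]
    have b1 : x ^ 4 ≤ 2 * (p * (x ^ 2 - 1)) := by
      have h1 : x ^ 2 * (x ^ 2 - 1) ≤ p * (x ^ 2 - 1) := mul_le_mul_of_nonneg_right hpx hx21.le
      have h2 : 0 ≤ x ^ 2 * (x ^ 2 - 2) := mul_nonneg (sq_nonneg x) (by nlinarith)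
      linarith
    have : 2 * (e * (1 + t ^ 2)) * x ^ 4 ≤ 2 * (e * (1 + t ^ 2)) * (2 * (p * (x ^ 2 - 1))) :=
      mul_le_mul_of_nonneg_left b1 (by positivity)
    linarith

lemma eulerEnergy_succ {e x p w w' y y' T : ℝ} (hs0 : 100 ≤ s) (he : e = 1 + s ^ 2)
    (hx : s + 1 ≤ x) (hp : p = x ^ 2 + t ^ 2) (hT : T = 1 + t ^ 2)
    (h1 : p * (y' - y) = w) (h2 : w' - w = -e * y') :
    eulerEnergy e (x + 1) w' y' ≤ (1 + 8 * e * T / x ^ 3) * eulerEnergy e (x - 1) w y := by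
  have hx0 : 0 < x := by linarith
  have hx1 : 0 < x - 1 := by linarith
  have hp0 : 0 < p := by rw [hp]; positivity
  have he0 : 0 < e := by rw [he]; positivity
  have he1 : 10000 ≤ e := by rw [he]; nlinarith
  have hT1 : 1 ≤ T := by rw [hT]; linarith [sq_nonneg t]
  have hlow := le_eulerEnergy (w := w) (y := y) (n := x - 1) hs0 he (by linarith)
  set Q := w ^ 2 / (x - 1) + e * (x - 1) * y ^ 2 with hQ
  have hQ0 : 0 ≤ Q := by positivity
  have hy' : y' = y + w / p := by rw [← h1]; field_simp; ring
  have hw' : w' = w - e * (y + w / p) := by rw [← hy']; linarith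
  have key := eulerEnergy_sub (t := t) (e := e) (w := w) (y := y) hx1.ne'
    (by linarith : x + 1 ≠ 0) hp0.ne' hp
  rw [← hw', ← hy'] at key
  obtain ⟨c1, c2⟩ := eulerEnergy_coeff_le (t := t) (by linarith : 2 ≤ x) he0 hp
  rw [← hT] at key c1 c2
  obtain ⟨hw2, hwy⟩ := mul_bounds_of_sum he1 hx1 hQ
  have t1 := mul_le_mul_of_nonneg_right c1 (sq_nonneg w)
  have hx21 : 0 < x ^ 2 - 1 := by nlinarith
  have t2 : -(2 * e * x * T / (p * (x ^ 2 - 1))) * (w * y) ≤ 4 * e * T / x ^ 3 * (Q / 200) := by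
    calc -(2 * e * x * T / (p * (x ^ 2 - 1))) * (w * y)
        = 2 * e * x * T / (p * (x ^ 2 - 1)) * -(w * y) := by ring
      _ ≤ 2 * e * x * T / (p * (x ^ 2 - 1)) * |w * y| :=
          mul_le_mul_of_nonneg_left (neg_le_abs _) (by positivity)
      _ ≤ _ := mul_le_mul c2 hwy (abs_nonneg _) (by positivity)
  have t3 : e / x ^ 4 * w ^ 2 ≤ e * T / x ^ 3 * Q := by
    have hxQ : (x - 1) * Q ≤ x * Q := mul_le_mul_of_nonneg_right (by linarith) hQ0
    calc e / x ^ 4 * w ^ 2 ≤ e / x ^ 4 * (x * Q) :=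
          mul_le_mul_of_nonneg_left (hw2.trans hxQ) (by positivity)
      _ = e * 1 / x ^ 3 * Q := by field_simp
      _ ≤ _ := by gcongr
  have t4 : 8 * e * T / x ^ 3 * (Q / 4) ≤ 8 * e * T / x ^ 3 * eulerEnergy e (x - 1) w y :=
    mul_le_mul_of_nonneg_left hlow (by positivity)
  have t5 : 0 ≤ e * T / x ^ 3 * Q := by positivity
  have t6 : 8 * e * T / x ^ 3 * (Q / 4) = 2 * (e * T / x ^ 3 * Q) := by ring
  have t7 : 4 * e * T / x ^ 3 * (Q / 200) = (e * T / x ^ 3 * Q) / 50 := by ring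
  linarith

/-- Upward propagation of the energy. -/
lemma sq_le_of_start (h : IsSol t s P f) (hs : 100 * (1 + |t|) ≤ s) {B : ℝ} {m : ℕ}
    (hm : s ≤ 2 * m) (hm' : (m : ℝ) ≤ s) (hf : f m ^ 2 ≤ B / s ^ 2)
    (hd : (f (m + 1) - f m) ^ 2 ≤ B / s ^ 2) (k : ℕ) (hk : m ≤ k) :
    f k ^ 2 * (s * (2 * k)) ≤ 1000 * B * exp (4 * (1 + t ^ 2)) := by
  have ht := sq_le_of_large hs
  have hs0 : 100 ≤ s := by have := abs_nonneg t; linarith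
  set e := 1 + s ^ 2 with he
  set T := 1 + t ^ 2 with hT
  have hT1 : 1 ≤ T := by rw [hT]; nlinarith [sq_nonneg t]
  have he0 : 0 < e := by positivity
  set w : ℕ → ℝ := fun k => P k * (f (k + 1) - f k) with hw
  have hB : 0 ≤ B := by
    have := (sq_nonneg _).trans hf
    have h2 := mul_nonneg this (by positivity : 0 ≤ s ^ 2)
    rwa [div_mul_cancel₀ _ (by positivity)] at h2
  have hEm : eulerEnergy e (2 * m) (w m) (f m) ≤ 200 * B * s := by
    have hm0 : (0 : ℝ) < 2 * m := by linarith
    have hP : P m ≤ 5 * s ^ 2 := by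
      rw [h.weight]
      have := pow_le_pow_left₀ (by positivity) (by linarith : 2 * (m : ℝ) + 1 ≤ 2 * s + 1) 2
      nlinarith
    have hw2 : w m ^ 2 ≤ 25 * s ^ 2 * B := by
      have h1 : P m ^ 2 ≤ (5 * s ^ 2) ^ 2 := pow_le_pow_left₀ (h.weight_pos m).le hP 2
      calc w m ^ 2 = P m ^ 2 * (f (m + 1) - f m) ^ 2 := by rw [hw]; ring
        _ ≤ (5 * s ^ 2) ^ 2 * (B / s ^ 2) := mul_le_mul h1 hd (sq_nonneg _) (by positivity)
        _ = _ := by field_simp; ring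
    have h1 : w m ^ 2 / (2 * m) ≤ 25 * B * s := by
      rw [div_le_iff₀ hm0]
      have : 25 * B * s * s ≤ 25 * B * s * (2 * m) := mul_le_mul_of_nonneg_left hm (by positivity)
      linarith
    have h2 : e * (2 * m + 1) * f m ^ 2 ≤ 5 * B * s := by
      have : e * (2 * m + 1) ≤ 5 * s ^ 3 := by
        calc e * (2 * m + 1) ≤ (1 + s ^ 2) * (2 * s + 1) := by gcongr
          _ ≤ 5 * s ^ 3 := by nlinarith [mul_nonneg (by linarith : 0 ≤ s - 100) (sq_nonneg s)]
      calc e * (2 * m + 1) * f m ^ 2 ≤ 5 * s ^ 3 * (B / s ^ 2) :=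
            mul_le_mul this hf (sq_nonneg _) (by positivity)
        _ = _ := by field_simp
    have h3 : (2 + e / (2 * m)) * (w m * f m) ≤ 60 * B * s := by
      have a1 : 2 + e / (2 * m) ≤ 2 * s := by
        have : e / (2 * m) ≤ s + 1 := by
          rw [div_le_iff₀ hm0]; nlinarith
        linarith
      have a2 : |w m * f m| ≤ 26 * B / 2 := by
        have : |w m * f m| ≤ (w m ^ 2 / s ^ 2  + s ^ 2 * f m ^ 2 ) / 2 := by
          rw [abs_le]
          have b1 : 0 ≤ (w m / s + s * f m) ^ 2 := sq_nonneg _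
          have b2 : 0 ≤ (w m / s - s * f m) ^ 2 := sq_nonneg _
          have b3 : (w m / s + s * f m) ^ 2 = w m ^ 2 / s ^ 2 + s ^ 2 * f m ^ 2 + 2 * (w m * f m) := by
            field_simp; ring
          have b4 : (w m / s - s * f m) ^ 2 = w m ^ 2 / s ^ 2 + s ^ 2 * f m ^ 2 - 2 * (w m * f m) := by
            field_simp; ring
          constructor <;> linarith
        have b5 : w m ^ 2 / s ^ 2 ≤ 25 * B := by
          rw [div_le_iff₀ (by positivity)]; linarith
        have b6 : s ^ 2 * f m ^ 2 ≤ B := by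
          rw [mul_comm]; exact (le_div_iff₀ (by positivity)).1 hf
        linarith
      have a3 : 0 ≤ 2 + e / (2 * m) := by positivity
      calc (2 + e / (2 * m)) * (w m * f m) ≤ (2 + e / (2 * m)) * |w m * f m| :=
            mul_le_mul_of_nonneg_left (le_abs_self _) a3
        _ ≤ 2 * s * (26 * B / 2) := mul_le_mul a1 a2 (abs_nonneg _) (by positivity)
        _ ≤ 60 * B * s := by nlinarith [mul_nonneg hB (by linarith : 0 ≤ s)]
    have hBs : 0 ≤ B * s := by positivity
    unfold eulerEnergy
    linarith
  have hmono : ∀ k, m ≤ k → eulerEnergy e (2 * k) (w k) (f k) * exp (2 * e * T / (2 * k) ^ 2) ≤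
      eulerEnergy e (2 * m) (w m) (f m) * exp (2 * e * T / (2 * m) ^ 2) := by
    intro k hk
    induction k, hk using Nat.le_induction with
    | base => exact le_rfl
    | succ k hk ih =>
      refine le_trans ?_ ih
      have hkr : (m : ℝ) ≤ k := by exact_mod_cast hk
      set x : ℝ := 2 * k + 1 with hx
      have hstep := eulerEnergy_succ (t := t) (x := x) (p := P k) (w := w k) (w' := w (k + 1)) (y := f k)
        (y' := f (k + 1)) hs0 he (by linarith) (by rw [h.weight]) hT rfl
        (by simp only [hw]; rw [he]; exact h.succ k)
      have e1 : x + 1 = 2 * ((k + 1 : ℕ) : ℝ) := by rw [hx]; push_cast; ring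
      have e2 : x - 1 = 2 * (k : ℝ) := by rw [hx]; ring
      rw [e1, e2] at hstep
      have hk0 : (0 : ℝ) < 2 * k := by linarith
      have hE0 : 0 ≤ eulerEnergy e (2 * k) (w k) (f k) :=
        le_trans (by positivity) (le_eulerEnergy hs0 he (by linarith))
      have hexp : 8 * e * T / x ^ 3 + 2 * e * T / (x + 1) ^ 2 ≤ 2 * e * T / (x - 1) ^ 2 := by
        have hx2 : 0 < x - 1 := by linarith
        have hx3 : 0 < x := by linarith
        have : 4 / x ^ 3 + 1 / (x + 1) ^ 2 ≤ 1 / (x - 1) ^ 2 := by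
          have e5 : 1 / (x - 1) ^ 2 - 1 / (x + 1) ^ 2 = 4 * x / ((x - 1) ^ 2 * (x + 1) ^ 2) := by
            field_simp; ring
          have e6 : 4 / x ^ 3 ≤ 4 * x / ((x - 1) ^ 2 * (x + 1) ^ 2) := by
            rw [div_le_div_iff₀ (by positivity) (by positivity)]
            nlinarith
          linarith
        calc 8 * e * T / x ^ 3 + 2 * e * T / (x + 1) ^ 2
            = 2 * e * T * (4 / x ^ 3 + 1 / (x + 1) ^ 2) := by ring
          _ ≤ 2 * e * T * (1 / (x - 1) ^ 2) := by gcongr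
          _ = _ := by ring
      rw [e1, e2] at hexp
      calc eulerEnergy e (2 * ((k + 1 : ℕ) : ℝ)) (w (k + 1)) (f (k + 1)) *
            exp (2 * e * T / (2 * ((k + 1 : ℕ) : ℝ)) ^ 2)
          ≤ ((1 + 8 * e * T / x ^ 3) * eulerEnergy e (2 * k) (w k) (f k)) *
            exp (2 * e * T / (2 * ((k + 1 : ℕ) : ℝ)) ^ 2) := by gcongr
        _ ≤ (exp (8 * e * T / x ^ 3) * eulerEnergy e (2 * k) (w k) (f k)) *
            exp (2 * e * T / (2 * ((k + 1 : ℕ) : ℝ)) ^ 2) := by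
            gcongr
            linarith [add_one_le_exp (8 * e * T / x ^ 3)]
        _ = eulerEnergy e (2 * k) (w k) (f k) *
            exp (8 * e * T / x ^ 3 + 2 * e * T / (2 * ((k + 1 : ℕ) : ℝ)) ^ 2) := by
            rw [exp_add]; ring
        _ ≤ _ := by gcongr
  have hk1 := hmono k hk
  have hkr : (m : ℝ) ≤ k := by exact_mod_cast hk
  have hlow := le_eulerEnergy (w := w k) (y := f k) hs0 he (by linarith : s ≤ 2 * k)
  have hk0 : (0 : ℝ) < 2 * k := by linarith
  have hE0 : 0 ≤ eulerEnergy e (2 * k) (w k) (f k) := le_trans (by positivity) hlow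
  have hone : eulerEnergy e (2 * k) (w k) (f k) ≤
      eulerEnergy e (2 * k) (w k) (f k) * exp (2 * e * T / (2 * k) ^ 2) :=
    le_mul_of_one_le_right hE0 (one_le_exp (by positivity))
  have hexpm : exp (2 * e * T / (2 * m) ^ 2) ≤ exp (4 * T) := by
    apply exp_le_exp.2
    have : s ^ 2 ≤ (2 * (m : ℝ)) ^ 2 := pow_le_pow_left₀ (by linarith) hm 2
    have hm0 : (0 : ℝ) < 2 * m := by linarith
    rw [div_le_iff₀ (by positivity)]
    nlinarith
  have hfin : eulerEnergy e (2 * k) (w k) (f k) ≤ 200 * B * s * exp (4 * T) :=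
    hone.trans (hk1.trans (mul_le_mul hEm hexpm (exp_pos _).le (by positivity)))
  have h5 : e * (2 * k) * f k ^ 2 ≤ 4 * (200 * B * s * exp (4 * T)) := by
    have : 0 ≤ w k ^ 2 / (2 * k) := by positivity
    linarith
  have h6 : s * (s * (2 * k) * f k ^ 2) ≤ s * (800 * B * exp (4 * T)) := by
    have : s ^ 2 * ((2 * k) * f k ^ 2) ≤ e * ((2 * k) * f k ^ 2) :=
      mul_le_mul_of_nonneg_right (by rw [he]; linarith) (by positivity)
    linarith
  have h7 := le_of_mul_le_mul_left h6 (by linarith)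
  have : 0 ≤ B * exp (4 * T) := by positivity
  linarith

/-- The coefficient of the first-order system satisfied by `f` and `P * (f + f (· + 1))`. -/
noncomputable def turn (t s : ℝ) (k : ℕ) : ℝ := 16 * (k : ℝ) ^ 2 + 3 + 4 * t ^ 2 - s ^ 2

lemma turn_mono {j k : ℕ} (hjk : j ≤ k) : turn t s j ≤ turn t s k := by
  have : (j : ℝ) ^ 2 ≤ (k : ℝ) ^ 2 := by gcongr
  unfold turn
  linarith

lemma flux_add (h : IsSol t s P f) (k : ℕ) :
    P (k + 1) * (f (k + 1) + f (k + 2)) + P k * (f k + f (k + 1)) = turn t s (k + 1) * f (k + 1) := by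
  have r := h.succ k
  rw [h.weight, h.weight] at r ⊢
  unfold turn
  push_cast at r ⊢
  linear_combination r

lemma flux_zero (h : IsSol t s P f) : 2 * (P 0 * (f 0 + f 1)) = turn t s 0 * f 0 := by
  have r := h.zero
  rw [h.weight] at r ⊢
  unfold turn
  push_cast at r ⊢
  linear_combination r

lemma mul_flux_nonneg (h : IsSol t s P f) (k : ℕ) (hk : turn t s k ≤ 0) :
    0 ≤ f (k + 1) * (P k * (f k + f (k + 1))) := by
  have aux : ∀ p a b V : ℝ, 0 < p → p * (a + b) = V → a * V ≤ 0 → 0 ≤ b * V := by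
    intro p a b V hp hV ha
    have : p * (b * V) = V ^ 2 - p * (a * V) := by rw [← hV]; ring
    have h2 : 0 ≤ p * (b * V) := by
      rw [this]; nlinarith [sq_nonneg V]
    exact nonneg_of_mul_nonneg_right h2 hp
  induction k with
  | zero =>
    refine aux _ _ _ _ (h.weight_pos 0) rfl ?_
    have e := h.flux_zero
    have : f 0 * (P 0 * (f 0 + f (0 + 1))) = turn t s 0 * (f 0 ^ 2 / 2) := by
      linear_combination f 0 / 2 * e
    rw [this]
    exact mul_nonpos_of_nonpos_of_nonneg hk (by positivity)
  | succ k ih =>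
    have ih := ih ((turn_mono (Nat.le_succ k)).trans hk)
    refine aux _ _ _ _ (h.weight_pos (k + 1)) rfl ?_
    have e := h.flux_add k
    have : f (k + 1) * (P (k + 1) * (f (k + 1) + f (k + 1 + 1))) =
        turn t s (k + 1) * f (k + 1) ^ 2 - f (k + 1) * (P k * (f k + f (k + 1))) := by
      linear_combination f (k + 1) * e
    rw [this]
    have := mul_nonpos_of_nonpos_of_nonneg hk (sq_nonneg (f (k + 1)))
    linarith

lemma sq_flux_le_succ (h : IsSol t s P f) (k : ℕ) (hk : turn t s (k + 1) ≤ 0) :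
    (P k * (f k + f (k + 1))) ^ 2 ≤ (P (k + 1) * (f (k + 1) + f (k + 2))) ^ 2 := by
  have h1 := h.mul_flux_nonneg k ((turn_mono (Nat.le_succ k)).trans hk)
  have e := h.flux_add k
  set V := P k * (f k + f (k + 1))
  have e' : P (k + 1) * (f (k + 1) + f (k + 2)) = turn t s (k + 1) * f (k + 1) - V := by linarith
  rw [e']
  nlinarith [mul_nonneg (neg_nonneg.2 hk) h1, sq_nonneg (turn t s (k + 1) * f (k + 1))]

/-- The energy used above the turning index. -/
noncomputable def turnEnergy (t s : ℝ) (P f : ℕ → ℝ) (k : ℕ) : ℝ :=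
  (P k * (f k + f (k + 1))) ^ 2 - turn t s (k + 1) * (P k * (f k + f (k + 1))) * f (k + 1) +
    turn t s (k + 1) * P (k + 1) * f (k + 1) ^ 2

lemma sub_turnEnergy (h : IsSol t s P f) (k : ℕ) :
    turnEnergy t s P f (k + 1) - turnEnergy t s P f k =
      -((turn t s (k + 2) - turn t s (k + 1)) * (P (k + 1) * (f (k + 1) + f (k + 2))) * f (k + 2)) +
      (turn t s (k + 2) * P (k + 2) - turn t s (k + 1) * P (k + 1)) * f (k + 2) ^ 2 := by
  have e := h.flux_add k
  have e' : P k * (f k + f (k + 1)) =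
    turn t s (k + 1) * f (k + 1) - P (k + 1) * (f (k + 1) + f (k + 2)) := by linarith
  unfold turnEnergy
  rw [e']
  simp only [add_assoc, Nat.reduceAdd]
  ring

lemma weight_le (h : IsSol t s P f) (hs : 100 * (1 + |t|) ≤ s) (k : ℕ) (hk : (k : ℝ) ≤ s + 1) :
    P k ≤ 5 * s ^ 2 := by
  have ht := sq_le_of_large hs
  have hs0 : 100 ≤ s := by have := abs_nonneg t; linarith
  rw [h.weight]
  have := pow_le_pow_left₀ (by positivity) (by linarith : 2 * (k : ℝ) + 1 ≤ 2 * s + 3) 2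
  nlinarith

lemma sq_flux_le_turnEnergy (h : IsSol t s P f) (hs : 100 * (1 + |t|) ≤ s) (k : ℕ)
    (hk : (k : ℝ) ≤ s) (hq : 0 ≤ turn t s (k + 1)) :
    (P k * (f k + f (k + 1))) ^ 2 ≤ 20 * turnEnergy t s P f k := by
  have hp := h.weight_pos (k + 1)
  have hP := h.weight_le hs (k + 1) (by push_cast; linarith)
  have hw := h.weight (k + 1)
  unfold turnEnergy
  set V := P k * (f k + f (k + 1))
  set q := turn t s (k + 1) with hqd
  set p := P (k + 1)
  have e4 : 4 * p - q = s ^ 2 + 16 * (k + 1) + 1 := by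
    rw [hw, hqd, turn]; push_cast; ring
  have h1 : q * V * f (k + 1) - q * p * f (k + 1) ^ 2 ≤ q * V ^ 2 / (4 * p) := by
    rw [le_div_iff₀ (by positivity)]
    nlinarith [mul_nonneg hq (sq_nonneg (V - 2 * p * f (k + 1)))]
  have h2 : V ^ 2 - q * V ^ 2 / (4 * p) = (4 * p - q) / (4 * p) * V ^ 2 := by field_simp
  have h3 : 1 / 20 ≤ (4 * p - q) / (4 * p) := by
    rw [div_le_div_iff₀ (by norm_num) (by positivity), e4]
    have : (0 : ℝ) ≤ k := by positivity
    linarith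
  have := mul_le_mul_of_nonneg_right h3 (sq_nonneg V)
  linarith

lemma turnEnergy_le_succ (h : IsSol t s P f) (hs : 100 * (1 + |t|) ≤ s) (k : ℕ)
    (hk : (k : ℝ) + 1 ≤ s) (hq : 0 ≤ turn t s (k + 1)) :
    turnEnergy t s P f k ≤ (1 + 320 / s) * turnEnergy t s P f (k + 1) := by
  have ht := sq_le_of_large hs
  have hs0 : 100 ≤ s := by have := abs_nonneg t; linarith
  have hp := h.weight_pos (k + 2)
  have hV := h.sq_flux_le_turnEnergy hs (k + 1) (by push_cast; exact hk)
    (hq.trans (turn_mono (Nat.le_succ _)))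
  have hsub := h.sub_turnEnergy k
  have w1 := h.weight (k + 1)
  have w2 := h.weight (k + 2)
  have hPm : P (k + 1) ≤ P (k + 2) := by
    rw [w1, w2]; push_cast; nlinarith [(Nat.cast_nonneg k : (0 : ℝ) ≤ k)]
  set d := turn t s (k + 2) - turn t s (k + 1) with hd
  have hde : d = 16 * (2 * k + 3) := by
    rw [hd]; unfold turn; push_cast; ring
  have hd0 : 0 ≤ d := by rw [hde]; positivity
  set V := P (k + 1) * (f (k + 1) + f (k + 2)) with hVd
  set y := f (k + 2)
  set p := P (k + 2)
  have h1 : d * p ≤ turn t s (k + 2) * p - turn t s (k + 1) * P (k + 1) := by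
    rw [hd]
    linarith [mul_le_mul_of_nonneg_left hPm hq]
  have h2 := mul_le_mul_of_nonneg_right h1 (sq_nonneg y)
  have h3 : d * V * y - d * p * y ^ 2 ≤ d / (4 * p) * V ^ 2 := by
    rw [div_mul_eq_mul_div, le_div_iff₀ (by positivity)]
    nlinarith [mul_nonneg hd0 (sq_nonneg (V - 2 * p * y))]
  have h4 : d / (4 * p) ≤ 16 / s := by
    have hk8 : s ≤ 8 * ((k : ℝ) + 1) := by
      have hq' : s ^ 2 ≤ 16 * ((k : ℝ) + 1) ^ 2 + 3 + 4 * t ^ 2 := by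
        unfold turn at hq; push_cast at hq; linarith
      have : s ^ 2 ≤ (8 * ((k : ℝ) + 1)) ^ 2 := by nlinarith
      exact le_of_sq_le_sq this (by positivity)
    rw [div_le_div_iff₀ (by positivity) (by linarith), hde, w2]
    push_cast
    nlinarith [(Nat.cast_nonneg k : (0 : ℝ) ≤ k), sq_nonneg t]
  have h5 : d / (4 * p) * V ^ 2 ≤ 16 / s * (20 * turnEnergy t s P f (k + 1)) :=
    mul_le_mul h4 hV (sq_nonneg _) (by positivity)
  have e6 : 16 / s * (20 * turnEnergy t s P f (k + 1)) = 320 / s * turnEnergy t s P f (k + 1) := by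
    ring
  linarith

lemma turnEnergy_start_le (h : IsSol t s P f) (hs : 100 * (1 + |t|) ≤ s) {B : ℝ} {m : ℕ}
    (hm : s ≤ 2 * m) (hm' : (m : ℝ) ≤ s) (hf : f m ^ 2 ≤ B / s ^ 2)
    (hd : (f (m + 1) - f m) ^ 2 ≤ B / s ^ 2) :
    turnEnergy t s P f m ≤ 1600 * B * s ^ 2 := by
  have hs0 : 100 ≤ s := by have := abs_nonneg t; linarith
  have hp0 := h.weight_pos m
  have hp1 := h.weight_pos (m + 1)
  have hP0 := h.weight_le hs m (by linarith)
  have hP1 := h.weight_le hs (m + 1) (by push_cast; linarith)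
  have hq0 : 0 ≤ turn t s (m + 1) := by
    unfold turn; push_cast; nlinarith [sq_nonneg t]
  have hq1 : turn t s (m + 1) ≤ 20 * s ^ 2 := by
    have : turn t s (m + 1) ≤ 4 * P (m + 1) := by
      rw [h.weight]; unfold turn; push_cast; nlinarith
    linarith
  have hsum : (f m + f (m + 1)) ^ 2 ≤ 10 * (B / s ^ 2) := by
    nlinarith [sq_nonneg (2 * f m - (f (m + 1) - f m))]
  have hy : f (m + 1) ^ 2 ≤ 4 * (B / s ^ 2) := by
    nlinarith [sq_nonneg (f m - (f (m + 1) - f m))]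
  have hB : 0 ≤ B / s ^ 2 := (sq_nonneg _).trans hf
  have hV : (P m * (f m + f (m + 1))) ^ 2 ≤ 250 * (s ^ 4 * (B / s ^ 2)) := by
    rw [mul_pow]
    have := mul_le_mul (pow_le_pow_left₀ hp0.le hP0 2) hsum (sq_nonneg _) (by positivity)
    linarith
  have hqy : (turn t s (m + 1) * f (m + 1)) ^ 2 ≤ 1600 * (s ^ 4 * (B / s ^ 2)) := by
    rw [mul_pow]
    have := mul_le_mul (pow_le_pow_left₀ hq0 hq1 2) hy (sq_nonneg _) (by positivity)
    linarith
  have hqp : turn t s (m + 1) * P (m + 1) * f (m + 1) ^ 2 ≤ 400 * (s ^ 4 * (B / s ^ 2)) := by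
    have := mul_le_mul (mul_le_mul hq1 hP1 hp1.le (by positivity)) hy (sq_nonneg _) (by positivity)
    linarith
  have e : s ^ 4 * (B / s ^ 2) = B * s ^ 2 := by field_simp
  rw [e] at hV hqy hqp
  have e0 : 0 ≤ B * s ^ 2 := by rw [← e]; positivity
  unfold turnEnergy
  nlinarith [sq_nonneg (P m * (f m + f (m + 1)) + turn t s (m + 1) * f (m + 1))]

lemma sq_flux_le (h : IsSol t s P f) (hs : 100 * (1 + |t|) ≤ s) {B : ℝ} {m : ℕ}
    (hm : s ≤ 2 * m) (hm' : (m : ℝ) ≤ s) (hf : f m ^ 2 ≤ B / s ^ 2)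
    (hd : (f (m + 1) - f m) ^ 2 ≤ B / s ^ 2) (k : ℕ) (hk : k ≤ m) :
    (P k * (f k + f (k + 1))) ^ 2 ≤ 32000 * exp 320 * B * s ^ 2 := by
  have hs0 : 100 ≤ s := by have := abs_nonneg t; linarith
  have hE := h.turnEnergy_start_le hs hm hm' hf hd
  have hback : ∀ j, j ≤ m → ∀ k, k + j = m → 0 ≤ turn t s (k + 1) →
      turnEnergy t s P f k ≤ exp (320 / s * j) * turnEnergy t s P f m := by
    intro j
    induction j with
    | zero => intro _ k hkj _; simp at hkj; subst hkj; simp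
    | succ j ih =>
      intro hj k hkj hq
      have hkr : (k : ℝ) + j + 1 = m := by
        have : k + j + 1 = m := by omega
        exact_mod_cast this
      have hj0 : (0 : ℝ) ≤ j := by positivity
      have hq' := hq.trans (turn_mono (t := t) (s := s) (Nat.le_succ (k + 1)))
      have h1 := h.turnEnergy_le_succ hs k (by linarith) hq
      have h2 := ih (by omega) (k + 1) (by omega) hq'
      have h3 := h.sq_flux_le_turnEnergy hs (k + 1) (by push_cast; linarith) hq'
      have h4 : 0 ≤ turnEnergy t s P f (k + 1) := by nlinarith [sq_nonneg (P (k + 1) * (f (k + 1) + f (k + 1 + 1)))]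
      calc turnEnergy t s P f k ≤ (1 + 320 / s) * turnEnergy t s P f (k + 1) := h1
        _ ≤ exp (320 / s) * (exp (320 / s * j) * turnEnergy t s P f m) := by
            refine mul_le_mul ?_ h2 h4 (exp_pos _).le
            linarith [add_one_le_exp (320 / s)]
        _ = _ := by rw [← mul_assoc, ← exp_add]; push_cast; ring_nf
  have hqm : 0 ≤ turn t s (m + 1) := by
    unfold turn; push_cast; nlinarith [sq_nonneg t]
  have hEm : 0 ≤ turnEnergy t s P f m := by
    have := h.sq_flux_le_turnEnergy hs m hm' hqm
    nlinarith [sq_nonneg (P m * (f m + f (m + 1)))]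
  have habove : ∀ k, k ≤ m → 0 ≤ turn t s (k + 1) →
      (P k * (f k + f (k + 1))) ^ 2 ≤ 32000 * exp 320 * B * s ^ 2 := by
    intro k hk hq
    have hkr : (k : ℝ) ≤ m := by exact_mod_cast hk
    have h1 := h.sq_flux_le_turnEnergy hs k (by linarith) hq
    have h2 := hback (m - k) (by omega) k (by omega) hq
    have h3 : exp (320 / s * ((m - k : ℕ) : ℝ)) ≤ exp 320 := by
      apply exp_le_exp.2
      have : ((m - k : ℕ) : ℝ) ≤ s := by
        rw [Nat.cast_sub hk]; linarith [(Nat.cast_nonneg k : (0 : ℝ) ≤ k)]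
      rw [div_mul_eq_mul_div, div_le_iff₀ (by linarith)]
      linarith
    have h4 := mul_le_mul h3 hE hEm (exp_pos _).le
    linarith
  induction hk using Nat.decreasingInduction with
  | self => exact habove m le_rfl hqm
  | of_succ k hk ih =>
    rcases le_total 0 (turn t s (k + 1)) with hq | hq
    · exact habove k (by omega) hq
    · exact (h.sq_flux_le_succ k hq).trans ih

/-- Decay beyond the classically forbidden region. -/
lemma sq_add_le_of_large_index (h : IsSol t s P f) (hs : 100 * (1 + |t|) ≤ s) {M : ℝ}
    (hS : ∀ N : ℕ, ∑ k ∈ Finset.range N, (f (k + 2) - 2 * f (k + 1) + f k) ^ 2 ≤ M / s)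
    (k : ℕ) (hk : s ≤ 8 * k) :
    (f k + f (k + 1)) ^ 2 * (s * (2 * k + 1)) ≤
      3200 * M * (8000 * exp (4 * (1 + t ^ 2)) + 2048000 * exp 320) := by
  have hs0 : 100 ≤ s := by have := abs_nonneg t; linarith
  obtain ⟨m, hm, hm', hf, hd⟩ := h.exists_start hs hS
  set B := 3200 * M with hBd
  have hB : 0 ≤ B := by
    have := (sq_nonneg _).trans hf
    have h2 := mul_nonneg this (by positivity : 0 ≤ s ^ 2)
    rwa [div_mul_cancel₀ _ (by positivity)] at h2
  have hexp := exp_pos (4 * (1 + t ^ 2))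
  have hexp' := exp_pos 320
  have p1 : 0 ≤ B * exp (4 * (1 + t ^ 2)) := by positivity
  have p2 : 0 ≤ B * exp 320 := by positivity
  have hk0 : (0 : ℝ) < k := by linarith
  rcases le_total m k with hmk | hkm
  · have h1 := h.sq_le_of_start hs hm hm' hf hd k hmk
    have h2 := h.sq_le_of_start hs hm hm' hf hd (k + 1) (by omega)
    push_cast at h2
    have h3 : (f k + f (k + 1)) ^ 2 ≤ 2 * f k ^ 2 + 2 * f (k + 1) ^ 2 := by
      nlinarith [sq_nonneg (f k - f (k + 1))]
    have hk1 : (1 : ℝ) ≤ 2 * k := by linarith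
    have h4 := mul_le_mul_of_nonneg_right h3 (by positivity : 0 ≤ s * (2 * k + 1))
    have h5 : f k ^ 2 * (s * (2 * k + 1)) ≤ 2 * (f k ^ 2 * (s * (2 * k))) := by
      have : 0 ≤ f k ^ 2 * s := by positivity
      nlinarith
    have h6 : f (k + 1) ^ 2 * (s * (2 * k + 1)) ≤ f (k + 1) ^ 2 * (s * (2 * (k + 1))) := by
      gcongr; linarith
    linarith
  · have h1 := h.sq_flux_le hs hm hm' hf hd k hkm
    have hp : (2 * (k : ℝ) + 1) ^ 2 ≤ P k := by rw [h.weight]; linarith [sq_nonneg t]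
    have h2 : (2 * (k : ℝ) + 1) ^ 4 ≤ P k ^ 2 := by
      have := pow_le_pow_left₀ (by positivity) hp 2
      rwa [← pow_mul] at this
    have h3 : s ^ 3 ≤ 64 * (2 * (k : ℝ) + 1) ^ 3 := by
      have := pow_le_pow_left₀ (by linarith) (by linarith : s ≤ 4 * (2 * (k : ℝ) + 1)) 3
      rw [mul_pow] at this
      linarith
    have h4 : s ^ 3 * (2 * k + 1) ≤ 64 * P k ^ 2 := by
      have := mul_le_mul_of_nonneg_right h3 (by positivity : (0 : ℝ) ≤ 2 * k + 1)
      linarith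
    have h5 := mul_le_mul_of_nonneg_left h4 (sq_nonneg (f k + f (k + 1)))
    have h6 : s ^ 2 * ((f k + f (k + 1)) ^ 2 * (s * (2 * k + 1))) ≤
        s ^ 2 * (64 * (32000 * exp 320 * B)) := by
      rw [mul_pow] at h1
      linarith
    have h7 := le_of_mul_le_mul_left h6 (by positivity)
    linarith

end IsSol

/-- The singular factor `|sin x|^σ`. -/
noncomputable def sinPow (σ : ℂ) (x : ℝ) : ℂ := pw |Real.sin x| σ

/-- The absolute singular weight `|sin x|^(-p)`. -/
noncomputable def sinWt (p x : ℝ) : ℝ := Real.exp (-p * Real.log |Real.sin x|)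

lemma sinPow_def (σ : ℂ) (x : ℝ) : sinPow σ x = Complex.exp (σ * (Real.log (Real.sin x) : ℂ)) := by
  unfold sinPow pw; rw [Real.log_abs]

lemma norm_sinPow {σ : ℂ} {p : ℝ} (hσ : σ.re = -p) (x : ℝ) : ‖sinPow σ x‖ = sinWt p x := by
  unfold sinPow pw sinWt
  rw [Complex.norm_exp, Complex.re_mul_ofReal, hσ]

lemma sinWt_pos (p x : ℝ) : 0 < sinWt p x := Real.exp_pos _

lemma measurable_sinWt (p : ℝ) : Measurable (sinWt p) := by
  unfold sinWt
  exact Real.measurable_exp.comp (measurable_const.mul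
    (Real.measurable_log.comp (Real.measurable_sin.abs)))

lemma measurable_sinPow (σ : ℂ) : Measurable (sinPow σ) := by
  unfold sinPow pw
  exact Complex.measurable_exp.comp (measurable_const.mul
    (Complex.measurable_ofReal.comp (Real.measurable_log.comp (Real.measurable_sin.abs))))

lemma sinWt_periodic (p : ℝ) : Function.Periodic (sinWt p) (2 * π) := by
  intro x; unfold sinWt; rw [Real.sin_add_two_pi]

lemma sinPow_periodic (σ : ℂ) : Function.Periodic (sinPow σ) (2 * π) := by
  intro x; unfold sinPow; rw [Real.sin_add_two_pi]

lemma sinWt_neg (p x : ℝ) : sinWt p (-x) = sinWt p x := by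
  unfold sinWt; rw [Real.sin_neg, abs_neg]

lemma sinPow_neg (σ : ℂ) (x : ℝ) : sinPow σ (-x) = sinPow σ x := by
  unfold sinPow; rw [Real.sin_neg, abs_neg]

lemma intervalIntegrable_sinWt {p : ℝ} (hp0 : 0 ≤ p) (hp : p < 1) (a b : ℝ) :
    IntervalIntegrable (sinWt p) volume a b := by
  have hper : Function.Periodic (sinWt p) π := by
    intro x; unfold sinWt; rw [Real.sin_add_pi, abs_neg]
  have hhalf : IntervalIntegrable (sinWt p) volume 0 (π / 2) := by
    have h1 : IntervalIntegrable (fun x : ℝ => (2 / π) ^ (-p) * x ^ (-p)) volume 0 (π / 2) :=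
      (intervalIntegral.intervalIntegrable_rpow' (by linarith)).const_mul _
    refine h1.mono_fun (measurable_sinWt p).aestronglyMeasurable ?_
    filter_upwards [ae_restrict_mem measurableSet_uIoc] with x hx
    rw [Set.uIoc_of_le (by positivity)] at hx
    have hx0 : 0 < 2 / π * x := mul_pos (by positivity) hx.1
    have hs := Real.mul_abs_le_abs_sin (x := x) (by rw [abs_of_pos hx.1]; exact hx.2)
    rw [abs_of_pos hx.1] at hs
    rw [Real.norm_of_nonneg (sinWt_pos p x).le, ← Real.mul_rpow (by positivity) hx.1.le]
    refine le_trans ?_ (le_abs_self _)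
    rw [Real.rpow_def_of_pos hx0]
    unfold sinWt
    apply Real.exp_le_exp.2
    have := Real.log_le_log hx0 hs
    nlinarith
  have hneg : IntervalIntegrable (sinWt p) volume (-(π / 2)) 0 := by
    have := (IntervalIntegrable.iff_comp_neg (f := sinWt p) (a := 0) (b := π / 2)).1 hhalf
    simp only [sinWt_neg, neg_zero] at this
    exact this.symm
  have hfull : IntervalIntegrable (sinWt p) volume (-(π / 2)) (-(π / 2) + π) := by
    have e : -(π / 2) + π = π / 2 := by ring
    rw [e]
    exact hneg.trans hhalf
  exact hper.intervalIntegrable Real.pi_pos.ne' hfull a b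

lemma intervalIntegrable_sinPow {σ : ℂ} (hσ : σ.re = -(1 / 2)) (a b : ℝ) :
    IntervalIntegrable (sinPow σ) volume a b := by
  refine (intervalIntegrable_sinWt (p := 1 / 2) (by norm_num) (by norm_num) a b).mono_fun
    (measurable_sinPow σ).aestronglyMeasurable (Filter.Eventually.of_forall fun x => ?_)
  beta_reduce
  rw [norm_sinPow hσ]
  exact le_abs_self _

lemma hasDerivAt_sinPow (σ : ℂ) {x : ℝ} (hx : Real.sin x ≠ 0) :
    HasDerivAt (sinPow σ) (σ * (Real.cos x / Real.sin x : ℝ) * sinPow σ x) x := by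
  have h1 : HasDerivAt (fun x : ℝ => Real.log (Real.sin x)) (Real.cos x / Real.sin x) x :=
    (Real.hasDerivAt_sin x).log hx
  have h2 := ((h1.ofReal_comp).const_mul σ).cexp
  have e : sinPow σ = fun x : ℝ => Complex.exp (σ * (Real.log (Real.sin x) : ℂ)) :=
    funext (sinPow_def σ)
  rw [e]
  convert h2 using 1
  ring

/-- The vector field coefficient vanishing on the singular set. -/
noncomputable def expSub (x : ℝ) : ℂ := Complex.exp (2 * Complex.I * x) - 1

lemma expSub_eq (x : ℝ) :
    expSub x = 2 * Complex.I * Real.sin x * Complex.exp (Complex.I * x) := by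
  unfold expSub
  have h := Complex.exp_mul_I (x : ℂ)
  have h2 : Complex.exp (2 * Complex.I * x) = Complex.exp (Complex.I * x) ^ 2 := by
    rw [← Complex.exp_nat_mul]; push_cast; ring_nf
  have h3 : Complex.exp (Complex.I * x) = Complex.cos x + Complex.sin x * Complex.I := by
    rw [mul_comm, h]
  rw [h2, h3, Complex.ofReal_sin]
  have h4 := Complex.sin_sq_add_cos_sq (x : ℂ)
  linear_combination h4 - (Complex.sin x) ^ 2 * Complex.I_sq

lemma norm_expSub (x : ℝ) : ‖expSub x‖ = 2 * |Real.sin x| := by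
  rw [expSub_eq, norm_mul, norm_mul, norm_mul, Complex.norm_I, mul_comm Complex.I,
    Complex.norm_exp_ofReal_mul_I, Complex.norm_real, Real.norm_eq_abs]
  simp

lemma continuous_expSub : Continuous expSub := by unfold expSub; fun_prop

lemma hasDerivAt_expSub (x : ℝ) :
    HasDerivAt expSub (2 * Complex.I * Complex.exp (2 * Complex.I * x)) x := by
  have h := (((hasDerivAt_id x).ofReal_comp).const_mul (2 * Complex.I)).cexp.sub_const (1 : ℂ)
  refine HasDerivAt.congr_deriv (f := expSub) h ?_
  simp only [id, Complex.ofReal_one]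
  ring

lemma norm_expSub_mul_sinPow {σ : ℂ} (hσ : σ.re = -(1 / 2)) (x : ℝ) :
    ‖expSub x * sinPow σ x‖ = 2 * Real.sqrt |Real.sin x| := by
  rw [norm_mul, norm_expSub, norm_sinPow hσ]
  rcases eq_or_lt_of_le (abs_nonneg (Real.sin x)) with h | h
  · rw [← h]; simp
  · have : sinWt (1 / 2) x = (Real.sqrt |Real.sin x|)⁻¹ := by
      unfold sinWt
      rw [neg_mul, Real.exp_neg, Real.sqrt_eq_rpow, Real.rpow_def_of_pos h, mul_comm]
    have h2 := Real.sqrt_pos.2 h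
    rw [this]
    nth_rewrite 1 [← Real.mul_self_sqrt h.le]
    field_simp

lemma norm_expSub_mul_sinPow_le {σ : ℂ} (hσ : σ.re = -(1 / 2)) (x : ℝ) :
    ‖expSub x * sinPow σ x‖ ≤ 2 := by
  rw [norm_expSub_mul_sinPow hσ]
  have := Real.sqrt_le_one.2 (Real.abs_sin_le_one x)
  linarith

lemma continuous_expSub_mul_sinPow {σ : ℂ} (hσ : σ.re = -(1 / 2)) :
    Continuous fun x => expSub x * sinPow σ x := by
  rw [continuous_iff_continuousAt]
  intro x
  by_cases hx : Real.sin x = 0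
  · have h0 : expSub x * sinPow σ x = 0 := by
      rw [← norm_eq_zero, norm_expSub_mul_sinPow hσ, hx]; simp
    unfold ContinuousAt
    beta_reduce
    rw [h0, tendsto_zero_iff_norm_tendsto_zero]
    simp only [norm_expSub_mul_sinPow hσ]
    have : Continuous fun x : ℝ => 2 * Real.sqrt |Real.sin x| := by fun_prop
    have h2 := this.tendsto x
    rw [hx] at h2
    simpa using h2
  · exact continuous_expSub.continuousAt.mul (hasDerivAt_sinPow σ hx).continuousAt

lemma countable_sin_eq_zero : {x : ℝ | Real.sin x = 0}.Countable := by
  refine (Set.countable_range (fun n : ℤ => (n : ℝ) * π)).mono ?_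
  intro x hx
  exact Real.sin_eq_zero_iff.1 hx

/-- Integration by parts against the singular factor. -/
lemma integral_sinPow_mul {σ : ℂ} (hσ : σ.re = -(1 / 2)) {h h' : ℝ → ℂ}
    (hd : ∀ x, HasDerivAt h (h' x) x) (hc : Continuous h') :
    ∫ x in (0 : ℝ)..(2 * π), sinPow σ x *
      (Complex.I * ((2 + σ) * Complex.exp (2 * Complex.I * x) + σ) * h x + expSub x * h' x) = 0 := by
  have hcont : Continuous h := continuous_iff_continuousAt.2 fun x => (hd x).continuousAt
  have key := MeasureTheory.integral_eq_of_hasDerivAt_off_countable_of_le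
    (fun x => expSub x * sinPow σ x * h x)
    (fun x => sinPow σ x *
      (Complex.I * ((2 + σ) * Complex.exp (2 * Complex.I * x) + σ) * h x + expSub x * h' x))
    (a := 0) (b := 2 * π) (by positivity) countable_sin_eq_zero
    ((continuous_expSub_mul_sinPow hσ).mul hcont).continuousOn ?_ ?_
  · rw [key]
    simp [expSub, mul_comm (2 : ℂ) Complex.I, mul_assoc]
    have h2 := Complex.exp_int_mul_two_pi_mul_I 2
    push_cast at h2
    rw [show Complex.I * (2 * (2 * (π : ℂ))) = 2 * (2 * π * Complex.I) by ring, h2, sub_self]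
    exact Or.inl rfl
  · rintro x ⟨-, hx⟩
    have hx' : Real.sin x ≠ 0 := hx
    refine HasDerivAt.congr_deriv (f := fun x => expSub x * sinPow σ x * h x)
      (((hasDerivAt_expSub x).mul (hasDerivAt_sinPow σ hx')).mul (hd x)) ?_
    have e : expSub x * ((Real.cos x / Real.sin x : ℝ) : ℂ) =
        Complex.I * (Complex.exp (2 * Complex.I * x) + 1) := by
      have h3 : Complex.exp (Complex.I * x) = Complex.cos x + Complex.sin x * Complex.I := by
        rw [mul_comm, Complex.exp_mul_I]
      have h4 : Complex.exp (2 * Complex.I * x) = Complex.exp (Complex.I * x) ^ 2 := by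
        rw [← Complex.exp_nat_mul]; push_cast; ring_nf
      have hs : (Real.sin x : ℂ) ≠ 0 := by exact_mod_cast hx'
      rw [expSub_eq, h4]
      push_cast
      rw [h3]
      have h5 := Complex.sin_sq_add_cos_sq (x : ℂ)
      have hs' : Complex.sin x ≠ 0 := by rwa [Complex.ofReal_sin] at hs
      field_simp
      linear_combination (1 : ℂ) * h5 - (Complex.sin x) ^ 2 * Complex.I_sq
    simp only [Pi.mul_apply]
    linear_combination (σ * sinPow σ x * h x) * e
  · refine (intervalIntegrable_sinPow hσ _ _).mul_continuousOn (Continuous.continuousOn ?_)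
    have := continuous_expSub
    fun_prop

/-- Unnormalized Fourier coefficient over a period. -/
noncomputable def hat (u : ℝ → ℂ) (m : ℤ) : ℂ :=
  ∫ x in (0 : ℝ)..(2 * π), u x * Complex.exp (Complex.I * m * x)

lemma hat_eq_fourierCoeffOn (u : ℝ → ℂ) (m : ℤ) :
    hat u m = 2 * π * fourierCoeffOn Real.two_pi_pos u (-m) := by
  rw [fourierCoeffOn_eq_integral]
  have : ∀ x : ℝ, fourier (- -m) (x : AddCircle (2 * π - 0)) • u x =
      u x * Complex.exp (Complex.I * m * x) := by
    intro x
    rw [fourier_coe_apply, smul_eq_mul, mul_comm]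
    congr 2
    have : (π : ℂ) ≠ 0 := by exact_mod_cast Real.pi_ne_zero
    push_cast
    rw [sub_zero]
    field_simp
  simp_rw [this]
  unfold hat
  rw [sub_zero, Complex.real_smul]
  have : (π : ℂ) ≠ 0 := by exact_mod_cast Real.pi_ne_zero
  push_cast
  field_simp

lemma hasSum_sq_hat {u : ℝ → ℂ} (hu : AEStronglyMeasurable u (volume.restrict (Set.Ioc 0 (2 * π))))
    {C : ℝ} (hC : ∀ᵐ x ∂(volume.restrict (Set.Ioc 0 (2 * π))), ‖u x‖ ≤ C) :
    HasSum (fun m : ℤ => ‖hat u m‖ ^ 2) (2 * π * ∫ x in (0 : ℝ)..(2 * π), ‖u x‖ ^ 2) := by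
  have hL : MemLp u 2 (volume.restrict (Set.Ioc 0 (2 * π))) := MemLp.of_bound hu C hC
  have h := (hasSum_sq_fourierCoeffOn Real.two_pi_pos hL).mul_left ((2 * π) ^ 2)
  rw [← (Equiv.neg ℤ).hasSum_iff] at h
  have e1 : (fun m : ℤ => ‖hat u m‖ ^ 2) =
      (fun i => (2 * π) ^ 2 * ‖fourierCoeffOn Real.two_pi_pos u i‖ ^ 2) ∘ (Equiv.neg ℤ) := by
    funext m
    simp only [Function.comp, Equiv.neg_apply]
    rw [hat_eq_fourierCoeffOn, norm_mul, mul_pow]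
    congr 2
    rw [show (2 * π : ℂ) = ((2 * π : ℝ) : ℂ) by push_cast; rfl, Complex.norm_real,
      Real.norm_of_nonneg Real.two_pi_pos.le]
  have e2 : 2 * π * ∫ x in (0 : ℝ)..(2 * π), ‖u x‖ ^ 2 =
      (2 * π) ^ 2 * ((2 * π - 0)⁻¹ • ∫ x in (0 : ℝ)..(2 * π), ‖u x‖ ^ 2) := by
    rw [sub_zero, smul_eq_mul]
    have := Real.pi_ne_zero
    field_simp
  rw [e1, e2]
  exact h

lemma integral_sq_le_of_norm_le {u : ℝ → ℂ} {C : ℝ} (hC : ∀ x, ‖u x‖ ≤ C) :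
    ∫ x in (0 : ℝ)..(2 * π), ‖u x‖ ^ 2 ≤ 2 * π * C ^ 2 := by
  have h := intervalIntegral.norm_integral_le_of_norm_le_const (a := 0) (b := 2 * π)
    (f := fun x => ‖u x‖ ^ 2) (C := C ^ 2) (fun x _ => by
      rw [norm_pow, norm_norm]
      exact pow_le_pow_left₀ (norm_nonneg _) (hC x) 2)
  rw [sub_zero, abs_of_pos Real.two_pi_pos] at h
  linarith [le_abs_self (∫ x in (0 : ℝ)..(2 * π), ‖u x‖ ^ 2), Real.norm_eq_abs (∫ x in (0 : ℝ)..(2 * π), ‖u x‖ ^ 2)]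

lemma continuous_cexp_int (m : ℤ) : Continuous fun x : ℝ => Complex.exp (Complex.I * m * x) := by
  fun_prop

lemma norm_cexp_int (m : ℤ) (x : ℝ) : ‖Complex.exp (Complex.I * m * x)‖ = 1 := by
  rw [show Complex.I * m * x = ((m * x : ℝ) : ℂ) * Complex.I by push_cast; ring,
    Complex.norm_exp_ofReal_mul_I]

lemma cexp_int_add_two (m : ℤ) (x : ℝ) : Complex.exp (Complex.I * ((m + 2 : ℤ) : ℂ) * x) =
    Complex.exp (2 * Complex.I * x) * Complex.exp (Complex.I * m * x) := by
  rw [← Complex.exp_add]; push_cast; ring_nf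

lemma hasDerivAt_cexp_int (m : ℤ) (x : ℝ) :
    HasDerivAt (fun x : ℝ => Complex.exp (Complex.I * m * x))
      (Complex.I * m * Complex.exp (Complex.I * m * x)) x := by
  have h := (((hasDerivAt_id x).ofReal_comp).const_mul (Complex.I * m)).cexp
  refine HasDerivAt.congr_deriv h ?_
  simp only [id, Complex.ofReal_one]
  ring

lemma cexp_int_periodic (m : ℤ) :
    Function.Periodic (fun x : ℝ => Complex.exp (Complex.I * m * x)) (2 * π) := by
  intro x
  have : Complex.I * m * ((x + 2 * π : ℝ) : ℂ) = Complex.I * m * x + m * (2 * π * Complex.I) := by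
    push_cast; ring
  simp only [this, Complex.exp_add, Complex.exp_int_mul_two_pi_mul_I, mul_one]

lemma intervalIntegrable_mul_cexp {u : ℝ → ℂ} (hu : IntervalIntegrable u volume 0 (2 * π)) (m : ℤ) :
    IntervalIntegrable (fun x : ℝ => u x * Complex.exp (Complex.I * m * x)) volume 0 (2 * π) :=
  hu.mul_continuousOn (continuous_cexp_int m).continuousOn

lemma hat_expSub_mul {u : ℝ → ℂ} (hu : IntervalIntegrable u volume 0 (2 * π)) (m : ℤ) :
    hat (fun x => expSub x * u x) m = hat u (m + 2) - hat u m := by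
  unfold hat
  rw [← intervalIntegral.integral_sub (intervalIntegrable_mul_cexp hu _)
    (intervalIntegrable_mul_cexp hu _)]
  congr 1
  funext x
  rw [cexp_int_add_two]
  unfold expSub
  ring

lemma hat_sinPow_rec {σ : ℂ} (hσ : σ.re = -(1 / 2)) (m : ℤ) :
    (m + 2 + σ) * hat (sinPow σ) (m + 2) = (m - σ) * hat (sinPow σ) m := by
  have h := integral_sinPow_mul hσ (hasDerivAt_cexp_int m) (by fun_prop)
  have hi := intervalIntegrable_sinPow hσ 0 (2 * π)
  have e : ∀ x : ℝ, sinPow σ x * (Complex.I * ((2 + σ) * Complex.exp (2 * Complex.I * x) + σ) *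
        Complex.exp (Complex.I * m * x) +
        expSub x * (Complex.I * m * Complex.exp (Complex.I * m * x))) =
      Complex.I * (m + 2 + σ) * (sinPow σ x * Complex.exp (Complex.I * ((m + 2 : ℤ) : ℂ) * x)) -
      Complex.I * (m - σ) * (sinPow σ x * Complex.exp (Complex.I * m * x)) := by
    intro x
    rw [cexp_int_add_two]
    unfold expSub
    ring
  simp_rw [e] at h
  rw [intervalIntegral.integral_sub ((intervalIntegrable_mul_cexp hi _).const_mul _)
    ((intervalIntegrable_mul_cexp hi _).const_mul _), intervalIntegral.integral_const_mul,
    intervalIntegral.integral_const_mul] at h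
  have h' : Complex.I * ((m + 2 + σ) * hat (sinPow σ) (m + 2) - (m - σ) * hat (sinPow σ) m) = 0 := by
    unfold hat
    linear_combination h
  have := (mul_eq_zero.1 h').resolve_left Complex.I_ne_zero
  linear_combination this

lemma hat_sinPow_neg (σ : ℂ) (m : ℤ) : hat (sinPow σ) (-m) = hat (sinPow σ) m := by
  unfold hat
  have h := intervalIntegral.integral_comp_sub_left (a := 0) (b := 2 * π)
    (fun x : ℝ => sinPow σ x * Complex.exp (Complex.I * m * x)) (2 * π)
  rw [sub_self, sub_zero] at h
  rw [← h]
  congr 1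
  funext x
  have e1 : sinPow σ (2 * π - x) = sinPow σ x := by
    rw [← sinPow_neg, neg_sub, (sinPow_periodic σ).sub_eq]
  have e2 := cexp_int_periodic m (-x)
  beta_reduce at e2
  rw [e1, show 2 * π - x = -x + 2 * π by ring, e2]
  congr 2
  push_cast
  ring

lemma hat_sinPow_odd {σ : ℂ} (hσ : σ.re = -(1 / 2)) (k : ℕ) : hat (sinPow σ) (2 * k + 1) = 0 := by
  have hne : ∀ r : ℝ, 0 ≤ r → (r : ℂ) + 1 + σ ≠ 0 := by
    intro r hr h
    have := congrArg Complex.re h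
    simp [hσ] at this
    linarith
  induction k with
  | zero =>
    have h := hat_sinPow_rec hσ (-1)
    rw [hat_sinPow_neg σ 1] at h
    have h2 : (2 * (1 + σ)) * hat (sinPow σ) 1 = 0 := by
      norm_num only [Int.cast_neg, Int.cast_one] at h
      linear_combination h
    simp only [Nat.cast_zero, mul_zero, zero_add]
    refine (mul_eq_zero.1 h2).resolve_left (mul_ne_zero two_ne_zero ?_)
    simpa using hne 0 le_rfl
  | succ k ih =>
    have h := hat_sinPow_rec hσ (2 * k + 1)
    rw [ih, mul_zero] at h
    have e : (2 * ((k + 1 : ℕ) : ℤ) + 1) = 2 * (k : ℤ) + 1 + 2 := by push_cast; ring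
    rw [e]
    refine (mul_eq_zero.1 h).resolve_left ?_
    have := hne (2 * k + 2) (by positivity)
    intro h0
    apply this
    push_cast at h0 ⊢
    linear_combination h0

lemma sq_norm_hat_succ {σ : ℂ} (hσ : σ.re = -(1 / 2)) (k : ℕ) :
    ((2 * k + 3 / 2) ^ 2 + σ.im ^ 2) * ‖hat (sinPow σ) (2 * (k + 1 : ℕ))‖ ^ 2 =
      ((2 * k + 1 / 2) ^ 2 + σ.im ^ 2) * ‖hat (sinPow σ) (2 * k)‖ ^ 2 ∧
    ((2 * k + 3 / 2) ^ 2 + σ.im ^ 2) *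
      ‖hat (sinPow σ) (2 * (k + 1 : ℕ)) - hat (sinPow σ) (2 * k)‖ ^ 2 =
      (1 + 4 * σ.im ^ 2) * ‖hat (sinPow σ) (2 * k)‖ ^ 2 := by
  have h := hat_sinPow_rec hσ (2 * k)
  have e : 2 * ((k + 1 : ℕ) : ℤ) = 2 * (k : ℤ) + 2 := by push_cast; ring
  rw [e]
  have n1 : ‖((2 * k : ℤ) : ℂ) + 2 + σ‖ ^ 2 = (2 * k + 3 / 2) ^ 2 + σ.im ^ 2 := by
    rw [← Complex.normSq_eq_norm_sq, Complex.normSq_apply]; simp [hσ]; ring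
  have n2 : ‖((2 * k : ℤ) : ℂ) - σ‖ ^ 2 = (2 * k + 1 / 2) ^ 2 + σ.im ^ 2 := by
    rw [← Complex.normSq_eq_norm_sq, Complex.normSq_apply]; simp [hσ]; ring
  have n3 : ‖2 + 2 * σ‖ ^ 2 = 1 + 4 * σ.im ^ 2 := by
    rw [← Complex.normSq_eq_norm_sq, Complex.normSq_apply]; simp [hσ]; ring
  rw [← n1, ← n2, ← n3, ← mul_pow, ← mul_pow, ← mul_pow, ← mul_pow, ← norm_mul, ← norm_mul,
    ← norm_mul, ← norm_mul]
  refine ⟨by rw [h], ?_⟩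
  have : (((2 * k : ℤ) : ℂ) + 2 + σ) * (hat (sinPow σ) (2 * k + 2) - hat (sinPow σ) (2 * k)) =
      -((2 + 2 * σ) * hat (sinPow σ) (2 * k)) := by linear_combination h
  rw [this, norm_neg]

lemma sq_norm_hat_sinPow_le {σ : ℂ} (hσ : σ.re = -(1 / 2)) (hw : 1 ≤ |σ.im|) (m : ℤ) :
    ‖hat (sinPow σ) m‖ ^ 2 ≤ 256 * π ^ 2 / |σ.im| := by
  set w := |σ.im| with hwd
  have hw2 : σ.im ^ 2 = w ^ 2 := by rw [hwd, sq_abs]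
  set a : ℕ → ℝ := fun k => ‖hat (sinPow σ) (2 * k)‖ ^ 2 with ha
  have ha0 : ∀ k, 0 ≤ a k := fun k => sq_nonneg _
  have hstep : ∀ k : ℕ, ((2 * k + 3 / 2) ^ 2 + w ^ 2) * a (k + 1) =
      ((2 * k + 1 / 2) ^ 2 + w ^ 2) * a k := fun k => hw2 ▸ (sq_norm_hat_succ hσ k).1
  have hdec : ∀ k, a k ≤ a 0 := by
    intro k
    induction k with
    | zero => exact le_rfl
    | succ k ih =>
      refine le_trans ?_ ih
      have h1 := hstep k
      have h2 : ((2 * (k : ℝ) + 3 / 2) ^ 2 + w ^ 2) * a (k + 1) ≤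
          ((2 * (k : ℝ) + 3 / 2) ^ 2 + w ^ 2) * a k := by
        rw [h1]; gcongr; norm_num
      exact le_of_mul_le_mul_left h2 (by positivity)
  have hinc : ∀ k : ℕ, w ^ 2 * a 0 ≤ ((2 * k + 1 / 2) ^ 2 + w ^ 2) * a k := by
    intro k
    induction k with
    | zero => have := ha0 0; push_cast; nlinarith
    | succ k ih =>
      have h1 := hstep k
      have h2 : ((2 * (k : ℝ) + 3 / 2) ^ 2 + w ^ 2) * a (k + 1) ≤
          ((2 * ((k + 1 : ℕ) : ℝ) + 1 / 2) ^ 2 + w ^ 2) * a (k + 1) := by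
        have := ha0 (k + 1)
        push_cast
        refine mul_le_mul_of_nonneg_right ?_ this
        have := pow_le_pow_left₀ (by positivity)
          (by linarith : 2 * (k : ℝ) + 3 / 2 ≤ 2 * (k + 1) + 1 / 2) 2
        linarith
      linarith
  have hd : ∀ k : ℕ, 2 * (k : ℝ) ≤ w →
      a 0 / 8 ≤ ‖hat (fun x => expSub x * sinPow σ x) (2 * k)‖ ^ 2 := by
    intro k hk
    have h1 := (sq_norm_hat_succ hσ k).2
    have e : 2 * ((k + 1 : ℕ) : ℤ) = 2 * (k : ℤ) + 2 := by push_cast; ring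
    rw [hat_expSub_mul (intervalIntegrable_sinPow hσ _ _)]
    rw [e, hw2] at h1
    have h2 := hinc k
    have hk0 : (0 : ℝ) ≤ k := by positivity
    have h3 : (2 * (k : ℝ) + 1 / 2) ^ 2 + w ^ 2 ≤ 4 * w ^ 2 := by nlinarith
    have h4 : (2 * (k : ℝ) + 3 / 2) ^ 2 + w ^ 2 ≤ 8 * w ^ 2 := by nlinarith
    have h5 : w ^ 2 * a 0 ≤ w ^ 2 * (4 * a k) := by
      have := mul_le_mul_of_nonneg_right h3 (ha0 k)
      linarith
    have h6 := le_of_mul_le_mul_left h5 (by positivity)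
    set d := ‖hat (sinPow σ) (2 * (k : ℤ) + 2) - hat (sinPow σ) (2 * (k : ℤ))‖ ^ 2 with hdd
    have h7 := mul_le_mul_of_nonneg_right h4 (by positivity : 0 ≤ d)
    have h8 : (1 + 4 * w ^ 2) * a k ≤ 8 * w ^ 2 * d := by
      exact (h1.symm.le.trans h7)
    have h9 : w ^ 2 * (a 0 / 8) ≤ w ^ 2 * d := by
      have := mul_le_mul_of_nonneg_left h6 (by positivity : 0 ≤ w ^ 2)
      have := ha0 k
      nlinarith
    exact le_of_mul_le_mul_left h9 (by positivity)
  have hsum := hasSum_sq_hat (u := fun x => expSub x * sinPow σ x)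
    (continuous_expSub_mul_sinPow hσ).aestronglyMeasurable
    (Filter.Eventually.of_forall (norm_expSub_mul_sinPow_le hσ))
  have hI := integral_sq_le_of_norm_le (norm_expSub_mul_sinPow_le hσ)
  set K := ⌊w / 2⌋₊ + 1 with hK
  have hK1 : w / 2 < K := by rw [hK]; push_cast; exact Nat.lt_floor_add_one _
  have hfin : ∑ k ∈ Finset.range K, ‖hat (fun x => expSub x * sinPow σ x) (2 * (k : ℤ))‖ ^ 2 ≤
      16 * π ^ 2 := by
    let g : ℕ ↪ ℤ := ⟨fun k => 2 * (k : ℤ), fun x y h => by simpa using h⟩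
    have h1 := sum_le_hasSum ((Finset.range K).map g) (fun i _ => sq_nonneg _) hsum
    rw [Finset.sum_map] at h1
    refine h1.trans ?_
    have := mul_le_mul_of_nonneg_left hI Real.two_pi_pos.le
    linarith
  have hlow : K * (a 0 / 8) ≤ 16 * π ^ 2 := by
    refine le_trans ?_ hfin
    rw [← nsmul_eq_mul, ← Finset.card_range K, ← Finset.sum_const, Finset.card_range]
    refine Finset.sum_le_sum fun k hk => hd k ?_
    have h1 : k ≤ ⌊w / 2⌋₊ := by have := Finset.mem_range.1 hk; omega
    have h2 : (k : ℝ) ≤ w / 2 := (Nat.cast_le.2 h1).trans (Nat.floor_le (by positivity))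
    linarith
  have hzero : a 0 ≤ 256 * π ^ 2 / w := by
    rw [le_div_iff₀ (by linarith)]
    have := mul_le_mul_of_nonneg_right hK1.le (ha0 0)
    linarith
  have hnat : ∀ m : ℕ, ‖hat (sinPow σ) m‖ ^ 2 ≤ 256 * π ^ 2 / w := by
    intro m
    rcases Nat.even_or_odd' m with ⟨k, rfl | rfl⟩
    · have := (hdec k).trans hzero
      push_cast
      exact this
    · push_cast
      rw [hat_sinPow_odd hσ, norm_zero, zero_pow two_ne_zero]
      positivity
  rcases Int.eq_nat_or_neg m with ⟨k, rfl | rfl⟩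
  · exact hnat k
  · rw [hat_sinPow_neg]; exact hnat k

/-- Lebesgue measure on one period. -/
noncomputable def perMeas : Measure ℝ := volume.restrict (Set.Ioc 0 (2 * π))

instance : IsFiniteMeasure perMeas := by unfold perMeas; infer_instance

lemma integral_perMeas {E : Type*} [NormedAddCommGroup E] [NormedSpace ℝ E] (u : ℝ → E) :
    ∫ x in (0 : ℝ)..(2 * π), u x = ∫ x, u x ∂perMeas :=
  intervalIntegral.integral_of_le Real.two_pi_pos.le

lemma integrable_perMeas {E : Type*} [NormedAddCommGroup E] {u : ℝ → E} :
    IntervalIntegrable u volume 0 (2 * π) ↔ Integrable u perMeas :=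
  intervalIntegrable_iff_integrableOn_Ioc_of_le Real.two_pi_pos.le

lemma integral_perMeas_add {E : Type*} [NormedAddCommGroup E] [NormedSpace ℝ E] {u : ℝ → E}
    (hu : Function.Periodic u (2 * π)) (a : ℝ) :
    ∫ x, u (x + a) ∂perMeas = ∫ x, u x ∂perMeas := by
  rw [← integral_perMeas, ← integral_perMeas, intervalIntegral.integral_comp_add_right, zero_add,
    add_comm (2 * π), hu.intervalIntegral_add_eq a 0, zero_add]

lemma integrable_perMeas_add {E : Type*} [NormedAddCommGroup E] {u : ℝ → E}
    (hu : Function.Periodic u (2 * π)) (hi : Integrable u perMeas) (a : ℝ) :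
    Integrable (fun x => u (x + a)) perMeas := by
  rw [← integrable_perMeas] at hi ⊢
  have h0 : IntervalIntegrable u volume 0 (0 + 2 * π) := by rwa [zero_add]
  have h1 : IntervalIntegrable u volume a (a + 2 * π) :=
    hu.intervalIntegrable Real.two_pi_pos.ne' h0 _ _
  have h2 := h1.comp_add_right a
  rwa [sub_self, add_sub_cancel_left] at h2

lemma integrable_mul_shift {𝕜 : Type*} [RCLike 𝕜] {u v : ℝ → 𝕜} (hum : Measurable u)
    (hu : Function.Periodic u (2 * π)) (hui : Integrable u perMeas) (hvm : Measurable v)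
    (hvi : Integrable v perMeas) (ε : ℝ) :
    Integrable (fun z : ℝ × ℝ => u (z.1 + ε * z.2) * v z.2) (perMeas.prod perMeas) := by
  have hm : Measurable fun z : ℝ × ℝ => u (z.1 + ε * z.2) * v z.2 :=
    (hum.comp (measurable_fst.add (measurable_snd.const_mul ε))).mul (hvm.comp measurable_snd)
  rw [integrable_prod_iff' hm.aestronglyMeasurable]
  constructor
  · exact Filter.Eventually.of_forall fun y => (integrable_perMeas_add hu hui (ε * y)).mul_const (v y)
  · have hun : Function.Periodic (fun x => ‖u x‖) (2 * π) := fun x => by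
      beta_reduce; rw [hu]
    have : ∀ y : ℝ, ∫ x, ‖u (x + ε * y) * v y‖ ∂perMeas = (∫ x, ‖u x‖ ∂perMeas) * ‖v y‖ := by
      intro y
      simp_rw [norm_mul]
      rw [integral_mul_const, integral_perMeas_add hun]
    simp_rw [this]
    exact hvi.norm.const_mul _

lemma integrable_sinWt {p : ℝ} (hp0 : 0 ≤ p) (hp : p < 1) : Integrable (sinWt p) perMeas :=
  integrable_perMeas.1 (intervalIntegrable_sinWt hp0 hp _ _)

lemma sinWt_mul_le (x y z : ℝ) : sinWt (1 / 2) x * sinWt (1 / 2) y * sinWt (1 / 2) z ≤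
    sinWt (3 / 4) x * sinWt (3 / 4) y + sinWt (3 / 4) x * sinWt (3 / 4) z +
      sinWt (3 / 4) y * sinWt (3 / 4) z := by
  unfold sinWt
  simp only [← Real.exp_add]
  have hx : Real.log |Real.sin x| ≤ 0 := Real.log_nonpos (abs_nonneg _) (Real.abs_sin_le_one x)
  have hy : Real.log |Real.sin y| ≤ 0 := Real.log_nonpos (abs_nonneg _) (Real.abs_sin_le_one y)
  have hz : Real.log |Real.sin z| ≤ 0 := Real.log_nonpos (abs_nonneg _) (Real.abs_sin_le_one z)
  set a := Real.log |Real.sin x|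
  set b := Real.log |Real.sin y|
  set c := Real.log |Real.sin z|
  have p1 := Real.exp_pos (-(3 / 4) * a + -(3 / 4) * b)
  have p2 := Real.exp_pos (-(3 / 4) * a + -(3 / 4) * c)
  have p3 := Real.exp_pos (-(3 / 4) * b + -(3 / 4) * c)
  rcases le_total (a + b) (2 * c) with h1 | h1
  · have := Real.exp_le_exp.2
      (by linarith : -(1 / 2) * a + -(1 / 2) * b + -(1 / 2) * c ≤ -(3 / 4) * a + -(3 / 4) * b)
    linarith
  · rcases le_total (a + c) (2 * b) with h2 | h2
    · have := Real.exp_le_exp.2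
        (by linarith : -(1 / 2) * a + -(1 / 2) * b + -(1 / 2) * c ≤ -(3 / 4) * a + -(3 / 4) * c)
      linarith
    · have := Real.exp_le_exp.2
        (by linarith : -(1 / 2) * a + -(1 / 2) * b + -(1 / 2) * c ≤ -(3 / 4) * b + -(3 / 4) * c)
      linarith

lemma measurable_sinWt_shift (p ε : ℝ) : Measurable fun z : ℝ × ℝ => sinWt p (z.1 + ε * z.2) :=
  (measurable_sinWt p).comp (measurable_fst.add (measurable_snd.const_mul ε))

lemma integrable_sinWt_triple {ε : ℝ} (hε : ε = 1 ∨ ε = -1) :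
    Integrable (fun z : ℝ × ℝ => sinWt (1 / 2) (z.1 + ε * z.2) * sinWt (1 / 2) z.1 *
      sinWt (1 / 2) z.2) (perMeas.prod perMeas) := by
  have hi := integrable_sinWt (p := 3 / 4) (by norm_num) (by norm_num)
  have hsh := integrable_mul_shift (measurable_sinWt (3 / 4)) (sinWt_periodic (3 / 4)) hi
    (measurable_sinWt (3 / 4)) hi ε
  have hsym : ∀ x y : ℝ, sinWt (3 / 4) (y + ε * x) = sinWt (3 / 4) (x + ε * y) := by
    intro x y
    rcases hε with rfl | rfl
    · rw [one_mul, one_mul, add_comm]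
    · rw [← sinWt_neg]; congr 1; ring
  have hsw : Integrable (fun z : ℝ × ℝ => sinWt (3 / 4) (z.1 + ε * z.2) * sinWt (3 / 4) z.1)
      (perMeas.prod perMeas) := by
    have := hsh.swap
    refine this.congr (Filter.Eventually.of_forall fun z => ?_)
    simp only [Function.comp, Prod.fst_swap, Prod.snd_swap]
    rw [hsym]
  refine ((hsw.add hsh).add (hi.mul_prod hi)).mono' ?_ (Filter.Eventually.of_forall fun z => ?_)
  · exact (((measurable_sinWt_shift _ ε).mul ((measurable_sinWt _).comp measurable_fst)).mul
      ((measurable_sinWt _).comp measurable_snd)).aestronglyMeasurable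
  · rw [Real.norm_of_nonneg (mul_pos (mul_pos (sinWt_pos _ _) (sinWt_pos _ _)) (sinWt_pos _ _)).le]
    exact sinWt_mul_le _ _ _

lemma integrable_sinPow {σ : ℂ} (hσ : σ.re = -(1 / 2)) : Integrable (sinPow σ) perMeas :=
  integrable_perMeas.1 (intervalIntegrable_sinPow hσ _ _)

lemma hat_eq (u : ℝ → ℂ) (m : ℤ) :
    hat u m = ∫ x, u x * Complex.exp (Complex.I * m * x) ∂perMeas := integral_perMeas _

/-- Correlation over one period. -/
noncomputable def corr (u v : ℝ → ℂ) (c : ℝ) : ℂ := ∫ y, u (y + c) * v y ∂perMeas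

lemma integrable_corr {u v : ℝ → ℂ} (hum : Measurable u) (hu : Function.Periodic u (2 * π))
    (hui : Integrable u perMeas) (hvm : Measurable v) (hvi : Integrable v perMeas) :
    Integrable (fun z : ℝ × ℝ => u (z.2 + z.1) * v z.2) (perMeas.prod perMeas) := by
  refine (integrable_mul_shift hum hu hui hvm hvi 1).congr
    (Filter.Eventually.of_forall fun z => ?_)
  beta_reduce
  rw [one_mul, add_comm]

lemma hat_corr {u v : ℝ → ℂ} (hum : Measurable u) (hu : Function.Periodic u (2 * π))
    (hui : Integrable u perMeas) (hvm : Measurable v) (hvi : Integrable v perMeas) (m : ℤ) :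
    hat (corr u v) m = hat u m * hat v (-m) := by
  have hexp : Continuous fun z : ℝ × ℝ => Complex.exp (Complex.I * m * z.1) :=
    (continuous_cexp_int m).comp continuous_fst
  have hint : Integrable (fun z : ℝ × ℝ => u (z.2 + z.1) * v z.2 *
      Complex.exp (Complex.I * m * z.1)) (perMeas.prod perMeas) :=
    (integrable_corr hum hu hui hvm hvi).mul_bdd (c := 1) hexp.aestronglyMeasurable
      (Filter.Eventually.of_forall fun z => (norm_cexp_int m z.1).le)
  have hper : Function.Periodic (fun x : ℝ => u x * Complex.exp (Complex.I * m * x)) (2 * π) := by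
    intro x
    have := cexp_int_periodic m x
    beta_reduce at this ⊢
    rw [this, hu]
  calc hat (corr u v) m
      = ∫ c, ∫ y, u (y + c) * v y * Complex.exp (Complex.I * m * c) ∂perMeas ∂perMeas := by
        rw [hat_eq]
        congr 1
        funext c
        rw [corr, integral_mul_const]
    _ = ∫ y, ∫ c, u (y + c) * v y * Complex.exp (Complex.I * m * c) ∂perMeas ∂perMeas :=
        integral_integral_swap hint
    _ = ∫ y, hat u m * (v y * Complex.exp (Complex.I * ((-m : ℤ) : ℂ) * y)) ∂perMeas := by
        congr 1
        funext y
        have h1 : ∀ c : ℝ, u (y + c) * v y * Complex.exp (Complex.I * m * c) =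
            (u (c + y) * Complex.exp (Complex.I * m * ((c + y : ℝ) : ℂ))) *
              (v y * Complex.exp (Complex.I * ((-m : ℤ) : ℂ) * y)) := by
          intro c
          have : Complex.exp (Complex.I * m * c) =
              Complex.exp (Complex.I * m * ((c + y : ℝ) : ℂ)) *
                Complex.exp (Complex.I * ((-m : ℤ) : ℂ) * y) := by
            rw [← Complex.exp_add]; push_cast; ring_nf
          rw [this, add_comm y c]
          ring
        simp_rw [h1]
        rw [integral_mul_const, integral_perMeas_add hper, hat_eq]
    _ = hat u m * hat v (-m) := by rw [integral_const_mul, ← hat_eq]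

lemma stronglyMeasurable_corr {u v : ℝ → ℂ} (hum : Measurable u) (hvm : Measurable v) :
    StronglyMeasurable (corr u v) := by
  have : Measurable fun z : ℝ × ℝ => u (z.2 + z.1) * v z.2 :=
    (hum.comp (measurable_snd.add measurable_fst)).mul (hvm.comp measurable_snd)
  exact this.stronglyMeasurable.integral_prod_right

/-- An `L²` bound for a bounded function whose Fourier coefficients are dominated by those of
another bounded function. -/
lemma integral_sq_le_of_hat_le {Z U : ℝ → ℂ} (hZ : AEStronglyMeasurable Z perMeas)
    (hU : AEStronglyMeasurable U perMeas) {B C K : ℝ} (hZB : ∀ x, ‖Z x‖ ≤ B)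
    (hUC : ∀ x, ‖U x‖ ≤ C) (hK : 0 ≤ K) (e : ℤ ≃ ℤ)
    (h : ∀ m, ‖hat Z m‖ ^ 2 ≤ K * ‖hat U (e m)‖ ^ 2) :
    ∫ x, ‖Z x‖ ^ 2 ∂perMeas ≤ K * (2 * π * C ^ 2) := by
  have h1 := hasSum_sq_hat hZ (Filter.Eventually.of_forall hZB)
  have h2 := (hasSum_sq_hat hU (Filter.Eventually.of_forall hUC)).mul_left K
  have h3 := (e.hasSum_iff).2 h2
  have h4 := hasSum_le h h1 h3
  have h5 := integral_sq_le_of_norm_le hUC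
  rw [← integral_perMeas]
  have h6 := mul_le_mul_of_nonneg_left h5 (by positivity : 0 ≤ K * (2 * π))
  have h7 : 2 * π * ∫ x in (0 : ℝ)..(2 * π), ‖Z x‖ ^ 2 ≤ 2 * π * (K * (2 * π * C ^ 2)) := by
    linarith
  exact le_of_mul_le_mul_left h7 Real.two_pi_pos

/-- The singular function whose Fourier coefficients are the model functional. -/
noncomputable def triKer (α β γ : ℂ) (c : ℝ) : ℂ :=
  sinPow α c * corr (sinPow β) (sinPow γ) c

lemma lker_eq (τ τ' lam : ℂ) (c : ℝ) : lker τ τ' lam c = (1 / (2 * (π : ℂ))) *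
    triKer ((-τ - τ' + lam - 1) / 2) ((-τ + τ' - lam - 1) / 2) ((τ - τ' - lam - 1) / 2) c := by
  unfold lker triKer corr Kker
  rw [integral_perMeas, ← integral_const_mul (sinPow _ c)]
  congr 2
  funext y
  unfold sinPow
  rw [add_sub_cancel_left, sub_zero, sub_zero, mul_assoc]

lemma integrable_triKer_prod {α β γ : ℂ} (hα : α.re = -(1 / 2)) (hβ : β.re = -(1 / 2))
    (hγ : γ.re = -(1 / 2)) :
    Integrable (fun z : ℝ × ℝ => sinPow α z.1 * (sinPow β (z.2 + z.1) * sinPow γ z.2))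
      (perMeas.prod perMeas) := by
  refine (integrable_sinWt_triple (Or.inl rfl)).mono' ?_ (Filter.Eventually.of_forall fun z => ?_)
  · exact (((measurable_sinPow α).comp measurable_fst).mul
      (((measurable_sinPow β).comp (measurable_snd.add measurable_fst)).mul
      ((measurable_sinPow γ).comp measurable_snd))).aestronglyMeasurable
  · rw [norm_mul, norm_mul, norm_sinPow hα, norm_sinPow hβ, norm_sinPow hγ, one_mul,
      add_comm z.2 z.1]
    apply le_of_eq; ring

lemma integrable_triKer {α β γ : ℂ} (hα : α.re = -(1 / 2)) (hβ : β.re = -(1 / 2))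
    (hγ : γ.re = -(1 / 2)) : Integrable (triKer α β γ) perMeas := by
  refine (integrable_triKer_prod hα hβ hγ).integral_prod_left.congr
    (Filter.Eventually.of_forall fun c => ?_)
  exact integral_const_mul (sinPow α c) fun y => sinPow β (y + c) * sinPow γ y

/-- The integral of the modulus of the model kernel. -/
noncomputable def triBound : ℝ :=
  ∫ z : ℝ × ℝ, sinWt (1 / 2) (z.1 + 1 * z.2) * sinWt (1 / 2) z.1 * sinWt (1 / 2) z.2
    ∂(perMeas.prod perMeas)

lemma norm_hat_triKer_le {α β γ : ℂ} (hα : α.re = -(1 / 2)) (hβ : β.re = -(1 / 2))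
    (hγ : γ.re = -(1 / 2)) (n : ℤ) : ‖hat (triKer α β γ) n‖ ≤ triBound := by
  have hexp : Continuous fun z : ℝ × ℝ => Complex.exp (Complex.I * n * z.1) :=
    (continuous_cexp_int n).comp continuous_fst
  have hint : Integrable (fun z : ℝ × ℝ => sinPow α z.1 * (sinPow β (z.2 + z.1) * sinPow γ z.2) *
      Complex.exp (Complex.I * n * z.1)) (perMeas.prod perMeas) :=
    (integrable_triKer_prod hα hβ hγ).mul_bdd (c := 1) hexp.aestronglyMeasurable
      (Filter.Eventually.of_forall fun z => (norm_cexp_int n z.1).le)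
  have : hat (triKer α β γ) n = ∫ z : ℝ × ℝ, sinPow α z.1 * (sinPow β (z.2 + z.1) * sinPow γ z.2) *
      Complex.exp (Complex.I * n * z.1) ∂(perMeas.prod perMeas) := by
    rw [integral_prod _ hint, hat_eq]
    congr 1
    funext c
    exact ((integral_mul_const _ _).trans (congrArg (· * _) (integral_const_mul _ _))).symm
  rw [this]
  refine norm_integral_le_of_norm_le (integrable_sinWt_triple (Or.inl rfl))
    (Filter.Eventually.of_forall fun z => ?_)
  rw [norm_mul, norm_mul, norm_mul, norm_cexp_int, norm_sinPow hα, norm_sinPow hβ,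
    norm_sinPow hγ, one_mul, add_comm z.2 z.1]
  apply le_of_eq; ring

lemma hat_add_hat {u : ℝ → ℂ} (hu : IntervalIntegrable u volume 0 (2 * π)) (n : ℤ) :
    ∫ c in (0 : ℝ)..(2 * π), u c * Complex.exp (Complex.I * n * c) *
      (1 + Complex.exp (2 * Complex.I * c)) = hat u n + hat u (n + 2) := by
  unfold hat
  rw [← intervalIntegral.integral_add (intervalIntegrable_mul_cexp hu n)
    (intervalIntegrable_mul_cexp hu (n + 2))]
  congr 1
  funext c
  rw [cexp_int_add_two]
  ring

lemma Ffun_eq {τ τ' lam : ℂ} (hτ : τ.re = 0) (hτ' : τ'.re = 0) (hlam : lam.re = 0) (n : ℤ) :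
    Ffun τ τ' lam n (fun c => 1 + Complex.exp (2 * Complex.I * (c : ℂ))) =
      (1 / (2 * (π : ℂ))) *
        (hat (triKer ((-τ - τ' + lam - 1) / 2) ((-τ + τ' - lam - 1) / 2)
          ((τ - τ' - lam - 1) / 2)) n +
        hat (triKer ((-τ - τ' + lam - 1) / 2) ((-τ + τ' - lam - 1) / 2)
          ((τ - τ' - lam - 1) / 2)) (n + 2)) := by
  have h := integrable_perMeas.2 (integrable_triKer (α := (-τ - τ' + lam - 1) / 2)
    (β := (-τ + τ' - lam - 1) / 2) (γ := (τ - τ' - lam - 1) / 2)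
    (by simp [hτ, hτ', hlam]; ring) (by simp [hτ, hτ', hlam]; ring) (by simp [hτ, hτ', hlam]; ring))
  rw [← hat_add_hat h, ← intervalIntegral.integral_const_mul]
  unfold Ffun
  congr 1
  funext c
  rw [lker_eq]
  ring

lemma expSub_periodic : Function.Periodic expSub (2 * π) := by
  intro x
  have := cexp_int_periodic 2 x
  unfold expSub
  push_cast at this ⊢
  rw [show (2 : ℂ) * Complex.I = Complex.I * 2 by ring, this]

lemma expSub_eq_cexp_mul (y c : ℝ) : expSub c =
    (expSub (y + c) - expSub y) * Complex.exp (Complex.I * ((-2 : ℤ) : ℂ) * y) := by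
  unfold expSub
  rw [sub_sub_sub_cancel_right, sub_mul, ← Complex.exp_add, ← Complex.exp_add]
  push_cast
  ring_nf
  rw [Complex.exp_zero]
  ring

lemma hat_cexp_mul (u : ℝ → ℂ) (j m : ℤ) :
    hat (fun y => Complex.exp (Complex.I * j * y) * u y) m = hat u (m + j) := by
  unfold hat
  congr 1
  funext x
  beta_reduce
  rw [mul_comm (Complex.exp _), mul_assoc, ← Complex.exp_add]
  push_cast
  ring_nf

lemma norm_corr_le {u v : ℝ → ℂ} {w : ℝ → ℝ} {c : ℝ} (hw : Integrable w perMeas)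
    (h : ∀ y, ‖u (y + c) * v y‖ ≤ w y) : ‖corr u v c‖ ≤ ∫ y, w y ∂perMeas :=
  norm_integral_le_of_norm_le hw (Filter.Eventually.of_forall h)

section SecondDifference

variable {β γ : ℂ}

/-- First part of `expSub · corr`. -/
noncomputable def corrLeft (β γ : ℂ) : ℝ → ℂ :=
  corr (fun x => expSub x * sinPow β x)
    (fun y => Complex.exp (Complex.I * ((-2 : ℤ) : ℂ) * y) * sinPow γ y)

/-- Second part of `expSub · corr`. -/
noncomputable def corrRight (β γ : ℂ) : ℝ → ℂ :=
  corr (sinPow β)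
    (fun y => Complex.exp (Complex.I * ((-2 : ℤ) : ℂ) * y) * (expSub y * sinPow γ y))

lemma integrable_cexp_mul {u : ℝ → ℂ} (hu : Integrable u perMeas) (j : ℤ) :
    Integrable (fun y : ℝ => Complex.exp (Complex.I * j * y) * u y) perMeas :=
  hu.bdd_mul (c := 1) (continuous_cexp_int j).aestronglyMeasurable
    (Filter.Eventually.of_forall fun z => (norm_cexp_int j z).le)

lemma norm_le_of_left (hβ : β.re = -(1 / 2)) (hγ : γ.re = -(1 / 2)) (c y : ℝ) :
    ‖(expSub (y + c) * sinPow β (y + c)) *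
      (Complex.exp (Complex.I * ((-2 : ℤ) : ℂ) * y) * sinPow γ y)‖ ≤ 2 * sinWt (1 / 2) y := by
  rw [norm_mul, norm_mul (Complex.exp _), norm_cexp_int, one_mul, norm_sinPow hγ]
  exact mul_le_mul_of_nonneg_right (norm_expSub_mul_sinPow_le hβ _) (sinWt_pos _ _).le

lemma norm_le_of_right (hβ : β.re = -(1 / 2)) (hγ : γ.re = -(1 / 2)) (c y : ℝ) :
    ‖sinPow β (y + c) *
      (Complex.exp (Complex.I * ((-2 : ℤ) : ℂ) * y) * (expSub y * sinPow γ y))‖ ≤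
      2 * sinWt (1 / 2) (y + c) := by
  rw [norm_mul, norm_mul (Complex.exp _), norm_cexp_int, one_mul, norm_sinPow hβ, mul_comm]
  exact mul_le_mul_of_nonneg_right (norm_expSub_mul_sinPow_le hγ _) (sinWt_pos _ _).le

lemma integrable_sinWt_half : Integrable (sinWt (1 / 2)) perMeas :=
  integrable_sinWt (by norm_num) (by norm_num)

lemma measurable_expSub_mul (σ : ℂ) : Measurable fun x => expSub x * sinPow σ x :=
  continuous_expSub.measurable.mul (measurable_sinPow σ)

lemma measurable_cexp_mul {u : ℝ → ℂ} (hu : Measurable u) (j : ℤ) :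
    Measurable fun y : ℝ => Complex.exp (Complex.I * j * y) * u y :=
  (continuous_cexp_int j).measurable.mul hu

lemma integrable_expSub_mul {σ : ℂ} (hσ : σ.re = -(1 / 2)) :
    Integrable (fun x => expSub x * sinPow σ x) perMeas :=
  Integrable.of_bound (measurable_expSub_mul σ).aestronglyMeasurable 2
    (Filter.Eventually.of_forall (norm_expSub_mul_sinPow_le hσ))

lemma expSub_mul_corr (hβ : β.re = -(1 / 2)) (hγ : γ.re = -(1 / 2)) (c : ℝ) :
    expSub c * corr (sinPow β) (sinPow γ) c = corrLeft β γ c - corrRight β γ c := by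
  have h1 : Integrable (fun y => (expSub (y + c) * sinPow β (y + c)) *
      (Complex.exp (Complex.I * ((-2 : ℤ) : ℂ) * y) * sinPow γ y)) perMeas :=
    (integrable_sinWt_half.const_mul 2).mono'
      (((measurable_expSub_mul β).comp (measurable_add_const c)).mul
        (measurable_cexp_mul (measurable_sinPow γ) _)).aestronglyMeasurable
      (Filter.Eventually.of_forall (norm_le_of_left hβ hγ c))
  have h2 : Integrable (fun y => sinPow β (y + c) *
      (Complex.exp (Complex.I * ((-2 : ℤ) : ℂ) * y) * (expSub y * sinPow γ y))) perMeas :=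
    ((integrable_perMeas_add (sinWt_periodic _) integrable_sinWt_half c).const_mul 2).mono'
      (((measurable_sinPow β).comp (measurable_add_const c)).mul
        (measurable_cexp_mul (measurable_expSub_mul γ) _)).aestronglyMeasurable
      (Filter.Eventually.of_forall (norm_le_of_right hβ hγ c))
  unfold corrLeft corrRight corr
  rw [← integral_sub h1 h2, ← integral_const_mul]
  congr 1
  funext y
  rw [expSub_eq_cexp_mul y c]
  ring

lemma norm_corrLeft_le (hβ : β.re = -(1 / 2)) (hγ : γ.re = -(1 / 2)) (c : ℝ) :
    ‖corrLeft β γ c‖ ≤ ∫ y, 2 * sinWt (1 / 2) y ∂perMeas :=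
  norm_corr_le (integrable_sinWt_half.const_mul 2) (norm_le_of_left hβ hγ c)

lemma norm_corrRight_le (hβ : β.re = -(1 / 2)) (hγ : γ.re = -(1 / 2)) (c : ℝ) :
    ‖corrRight β γ c‖ ≤ ∫ y, 2 * sinWt (1 / 2) y ∂perMeas := by
  have := norm_corr_le
    ((integrable_perMeas_add (sinWt_periodic _) integrable_sinWt_half c).const_mul 2)
    (norm_le_of_right hβ hγ c)
  rwa [integral_perMeas_add (u := fun y => 2 * sinWt (1 / 2) y)
    (fun x => by beta_reduce; rw [sinWt_periodic])] at this

lemma measurable_corrLeft (β γ : ℂ) : StronglyMeasurable (corrLeft β γ) :=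
  stronglyMeasurable_corr (measurable_expSub_mul β) (measurable_cexp_mul (measurable_sinPow γ) _)

lemma measurable_corrRight (β γ : ℂ) : StronglyMeasurable (corrRight β γ) :=
  stronglyMeasurable_corr (measurable_sinPow β) (measurable_cexp_mul (measurable_expSub_mul γ) _)

lemma integral_sq_corrLeft_le (hβ : β.re = -(1 / 2)) (hγ : γ.re = -(1 / 2)) {K : ℝ}
    (hK : ∀ m, ‖hat (sinPow γ) m‖ ^ 2 ≤ K) :
    ∫ c, ‖corrLeft β γ c‖ ^ 2 ∂perMeas ≤ K * (2 * π * 2 ^ 2) := by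
  refine integral_sq_le_of_hat_le (measurable_corrLeft β γ).aestronglyMeasurable
    (measurable_expSub_mul β).aestronglyMeasurable (norm_corrLeft_le hβ hγ)
    (norm_expSub_mul_sinPow_le hβ) ((sq_nonneg _).trans (hK 0)) (Equiv.refl ℤ) fun m => ?_
  have : hat (corrLeft β γ) m = hat (fun x => expSub x * sinPow β x) m *
      hat (sinPow γ) (-m + -2) := by
    unfold corrLeft
    rw [hat_corr (measurable_expSub_mul β)
      (expSub_periodic.mul (sinPow_periodic β)) (integrable_expSub_mul hβ)
      (measurable_cexp_mul (measurable_sinPow γ) _)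
      (integrable_cexp_mul (integrable_sinPow hγ) _), hat_cexp_mul]
  rw [this, norm_mul, mul_pow, mul_comm]
  exact mul_le_mul_of_nonneg_right (hK _) (sq_nonneg _)

lemma integral_sq_corrRight_le (hβ : β.re = -(1 / 2)) (hγ : γ.re = -(1 / 2)) {K : ℝ}
    (hK : ∀ m, ‖hat (sinPow β) m‖ ^ 2 ≤ K) :
    ∫ c, ‖corrRight β γ c‖ ^ 2 ∂perMeas ≤ K * (2 * π * 2 ^ 2) := by
  refine integral_sq_le_of_hat_le (measurable_corrRight β γ).aestronglyMeasurable
    (measurable_expSub_mul γ).aestronglyMeasurable (norm_corrRight_le hβ hγ)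
    (norm_expSub_mul_sinPow_le hγ) ((sq_nonneg _).trans (hK 0))
    ((Equiv.neg ℤ).trans (Equiv.addRight (-2))) fun m => ?_
  have : hat (corrRight β γ) m = hat (sinPow β) m *
      hat (fun x => expSub x * sinPow γ x) (-m + -2) := by
    unfold corrRight
    rw [hat_corr (measurable_sinPow β) (sinPow_periodic β) (integrable_sinPow hβ)
      (measurable_cexp_mul (measurable_expSub_mul γ) _)
      (integrable_cexp_mul (integrable_expSub_mul hγ) _), hat_cexp_mul]
  rw [this, norm_mul, mul_pow]
  exact mul_le_mul_of_nonneg_right (hK _) (sq_nonneg _)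

lemma sum_sq_second_diff_le {α : ℂ} (hα : α.re = -(1 / 2)) (hβ : β.re = -(1 / 2))
    (hγ : γ.re = -(1 / 2)) {K : ℝ} (hKβ : ∀ m, ‖hat (sinPow β) m‖ ^ 2 ≤ K)
    (hKγ : ∀ m, ‖hat (sinPow γ) m‖ ^ 2 ≤ K) (S : Finset ℤ) :
    ∑ m ∈ S, ‖hat (triKer α β γ) (m + 4) - 2 * hat (triKer α β γ) (m + 2) +
      hat (triKer α β γ) m‖ ^ 2 ≤ 256 * π ^ 2 * K := by
  set J := triKer α β γ with hJ
  have hJi : IntervalIntegrable J volume 0 (2 * π) :=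
    integrable_perMeas.2 (integrable_triKer hα hβ hγ)
  have hJ1 : IntervalIntegrable (fun x => expSub x * J x) volume 0 (2 * π) :=
    hJi.continuousOn_mul continuous_expSub.continuousOn
  set W : ℝ → ℂ := fun x => expSub x * (expSub x * J x) with hW
  have hdiff : ∀ m, hat J (m + 4) - 2 * hat J (m + 2) + hat J m = hat W m := by
    intro m
    rw [hW, hat_expSub_mul hJ1, hat_expSub_mul hJi, hat_expSub_mul hJi, add_assoc]
    ring_nf
  simp_rw [hdiff]
  have hWeq : ∀ c, W c = (expSub c * sinPow α c) * (corrLeft β γ c - corrRight β γ c) := by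
    intro c
    rw [← expSub_mul_corr hβ hγ, hW, hJ]
    unfold triKer
    ring
  have hWm : AEStronglyMeasurable W perMeas := by
    rw [show W = _ from funext hWeq]
    exact (measurable_expSub_mul α).aestronglyMeasurable.mul
      ((measurable_corrLeft β γ).aestronglyMeasurable.sub
        (measurable_corrRight β γ).aestronglyMeasurable)
  set B := ∫ y, 2 * sinWt (1 / 2) y ∂perMeas with hB
  have hWn : ∀ c, ‖W c‖ ≤ 2 * ‖corrLeft β γ c - corrRight β γ c‖ := by
    intro c
    rw [hWeq, norm_mul]
    exact mul_le_mul_of_nonneg_right (norm_expSub_mul_sinPow_le hα c) (norm_nonneg _)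
  have hWB : ∀ c, ‖W c‖ ≤ 2 * (B + B) := fun c =>
    (hWn c).trans (mul_le_mul_of_nonneg_left ((norm_sub_le _ _).trans
      (add_le_add (norm_corrLeft_le hβ hγ c) (norm_corrRight_le hβ hγ c))) two_pos.le)
  have hs := hasSum_sq_hat hWm (Filter.Eventually.of_forall hWB)
  refine (sum_le_hasSum S (fun _ _ => sq_nonneg _) hs).trans ?_
  have hi : ∀ {Z : ℝ → ℂ}, StronglyMeasurable Z → (∀ c, ‖Z c‖ ≤ B) →
      Integrable (fun c => ‖Z c‖ ^ 2) perMeas := by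
    intro Z hZ hZB
    refine Integrable.of_bound (hZ.norm.pow 2).aestronglyMeasurable (B ^ 2)
      (Filter.Eventually.of_forall fun c => ?_)
    rw [norm_pow, norm_norm]
    exact pow_le_pow_left₀ (norm_nonneg _) (hZB c) 2
  have hiL := hi (measurable_corrLeft β γ) (norm_corrLeft_le hβ hγ)
  have hiR := hi (measurable_corrRight β γ) (norm_corrRight_le hβ hγ)
  have hle : ∫ c, ‖W c‖ ^ 2 ∂perMeas ≤
      ∫ c, 8 * (‖corrLeft β γ c‖ ^ 2 + ‖corrRight β γ c‖ ^ 2) ∂perMeas := by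
    refine integral_mono_of_nonneg (Filter.Eventually.of_forall fun c => sq_nonneg _)
      ((hiL.add hiR).const_mul 8) (Filter.Eventually.of_forall fun c => ?_)
    beta_reduce
    have h1 := (hWn c).trans (mul_le_mul_of_nonneg_left (norm_sub_le _ _) two_pos.le)
    have h2 := pow_le_pow_left₀ (norm_nonneg _) h1 2
    nlinarith [sq_nonneg (‖corrLeft β γ c‖ - ‖corrRight β γ c‖)]
  rw [integral_const_mul, integral_add hiL hiR] at hle
  have hL := integral_sq_corrLeft_le hβ hγ hKγ
  have hR := integral_sq_corrRight_le hβ hγ hKβ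
  rw [integral_perMeas]
  have : ∫ c, ‖W c‖ ^ 2 ∂perMeas ≤ 128 * π * K := by linarith
  nlinarith [Real.pi_pos]

end SecondDifference

lemma integrable_mul_continuous {F X : ℝ × ℝ → ℂ} (hF : Integrable F (perMeas.prod perMeas))
    (hX : Continuous X) : Integrable (fun z => F z * X z) (perMeas.prod perMeas) := by
  have hK : IsCompact (Set.Icc (0 : ℝ) (2 * π) ×ˢ Set.Icc (0 : ℝ) (2 * π)) :=
    isCompact_Icc.prod isCompact_Icc
  obtain ⟨C, hC⟩ := hK.exists_bound_of_continuousOn hX.continuousOn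
  refine hF.mul_bdd (c := C) hX.aestronglyMeasurable ?_
  unfold perMeas
  rw [Measure.prod_restrict]
  filter_upwards [ae_restrict_mem (measurableSet_Ioc.prod measurableSet_Ioc)] with z hz
  exact hC z ⟨Set.Ioc_subset_Icc_self hz.1, Set.Ioc_subset_Icc_self hz.2⟩

/-- A smooth regularization of `sinPow`. -/
noncomputable def regPow (α : ℂ) (ε c : ℝ) : ℂ :=
  Complex.exp (α / 2 * (Real.log (Real.sin c ^ 2 + ε ^ 2) : ℂ))

/-- The factor `sin² / (sin² + ε²)`. -/
noncomputable def regRatio (ε c : ℝ) : ℝ := Real.sin c ^ 2 / (Real.sin c ^ 2 + ε ^ 2)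

lemma sin_sq_add_ne_zero {ε : ℝ} (hε : ε ≠ 0) (c : ℝ) : Real.sin c ^ 2 + ε ^ 2 ≠ 0 := by
  positivity

lemma hasDerivAt_regPow (α : ℂ) {ε : ℝ} (hε : ε ≠ 0) (c : ℝ) :
    HasDerivAt (regPow α ε)
      (α * ((Real.sin c * Real.cos c / (Real.sin c ^ 2 + ε ^ 2) : ℝ) : ℂ) * regPow α ε c) c := by
  have h := (((((Real.hasDerivAt_sin c).pow 2).add_const (ε ^ 2)).log
    (sin_sq_add_ne_zero hε c)).ofReal_comp.const_mul (α / 2)).cexp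
  refine HasDerivAt.congr_deriv h ?_
  unfold regPow
  push_cast
  simp only [pow_one, Pi.pow_apply]
  push_cast
  ring

lemma continuous_regPow (α : ℂ) {ε : ℝ} (hε : ε ≠ 0) : Continuous (regPow α ε) :=
  continuous_iff_continuousAt.2 fun c => (hasDerivAt_regPow α hε c).continuousAt

lemma norm_regPow_le {α : ℂ} (hα : α.re = -(1 / 2)) (ε : ℝ) {c : ℝ} (hc : Real.sin c ≠ 0) :
    ‖regPow α ε c‖ ≤ sinWt (1 / 2) c := by
  unfold regPow sinWt
  rw [Complex.norm_exp, Complex.re_mul_ofReal]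
  apply Real.exp_le_exp.2
  have h1 : (α / 2).re = -(1 / 4) := by
    rw [show α / 2 = α * ((1 / 2 : ℝ) : ℂ) by push_cast; ring, Complex.re_mul_ofReal, hα]
    norm_num
  have h2 : Real.log (Real.sin c ^ 2) ≤ Real.log (Real.sin c ^ 2 + ε ^ 2) :=
    Real.log_le_log (by positivity) (le_add_of_nonneg_right (sq_nonneg ε))
  rw [Real.log_pow] at h2
  rw [h1, Real.log_abs]
  push_cast at h2
  linarith

lemma tendsto_regPow (α : ℂ) {c : ℝ} (hc : Real.sin c ≠ 0) :
    Filter.Tendsto (fun k : ℕ => regPow α (1 / ((k : ℝ) + 1)) c) Filter.atTop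
      (nhds (sinPow α c)) := by
  have h0 : Real.sin c ^ 2 + (0 : ℝ) ^ 2 ≠ 0 := by positivity
  have h1 : ContinuousAt (fun ε : ℝ => regPow α ε c) 0 := by
    unfold regPow
    have : ContinuousAt (fun ε : ℝ => Real.log (Real.sin c ^ 2 + ε ^ 2)) 0 :=
      ContinuousAt.log (by fun_prop) h0
    fun_prop
  have h2 : regPow α 0 c = sinPow α c := by
    rw [sinPow_def]
    unfold regPow
    rw [zero_pow two_ne_zero, add_zero, Real.log_pow]
    push_cast
    ring_nf
  have h3 := h1.tendsto.comp tendsto_one_div_add_atTop_nhds_zero_nat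
  rwa [h2] at h3

lemma tendsto_regRatio {c : ℝ} (hc : Real.sin c ≠ 0) :
    Filter.Tendsto (fun k : ℕ => regRatio (1 / ((k : ℝ) + 1)) c) Filter.atTop (nhds 1) := by
  have h0 : Real.sin c ^ 2 + (0 : ℝ) ^ 2 ≠ 0 := by positivity
  have h1 : ContinuousAt (fun ε : ℝ => regRatio ε c) 0 := by
    unfold regRatio
    exact ContinuousAt.div (by fun_prop) (by fun_prop) h0
  have h2 : regRatio 0 c = 1 := by
    unfold regRatio
    rw [zero_pow two_ne_zero, add_zero, div_self (by positivity)]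
  have h3 := h1.tendsto.comp tendsto_one_div_add_atTop_nhds_zero_nat
  rwa [h2] at h3

lemma regRatio_mem (ε c : ℝ) : 0 ≤ regRatio ε c ∧ regRatio ε c ≤ 1 := by
  unfold regRatio
  refine ⟨by positivity, div_le_one_of_le₀ (le_add_of_nonneg_right (sq_nonneg ε)) (by positivity)⟩

lemma continuous_regRatio {ε : ℝ} (hε : ε ≠ 0) : Continuous (regRatio ε) := by
  unfold regRatio
  exact Continuous.div (by fun_prop) (by fun_prop) (sin_sq_add_ne_zero hε)

lemma cexp_sub_cexp_mul (ε x y : ℝ) :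
    ((Real.sin (x - y) * Real.cos (x - y) / (Real.sin (x - y) ^ 2 + ε ^ 2) : ℝ) : ℂ) *
      (Complex.exp (2 * Complex.I * x) - Complex.exp (2 * Complex.I * y)) =
    Complex.I * (regRatio ε (x - y) : ℂ) *
      (Complex.exp (2 * Complex.I * x) + Complex.exp (2 * Complex.I * y)) := by
  have hx : Complex.exp (2 * Complex.I * x) =
      Complex.exp (((x - y : ℝ) : ℂ) * Complex.I) * Complex.exp (Complex.I * (x + y)) := by
    rw [← Complex.exp_add]; push_cast; ring_nf
  have hy : Complex.exp (2 * Complex.I * y) =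
      Complex.exp (((-(x - y) : ℝ) : ℂ) * Complex.I) * Complex.exp (Complex.I * (x + y)) := by
    rw [← Complex.exp_add]; push_cast; ring_nf
  rw [hx, hy]
  unfold regRatio
  rw [Complex.exp_mul_I, Complex.exp_mul_I]
  simp only [← Complex.ofReal_cos, ← Complex.ofReal_sin, Real.cos_neg, Real.sin_neg]
  push_cast
  ring

lemma ae_sin_sub_ne_zero :
    ∀ᵐ z : ℝ × ℝ ∂(perMeas.prod perMeas), Real.sin (z.1 - z.2) ≠ 0 := by
  have hm : MeasurableSet {z : ℝ × ℝ | Real.sin (z.1 - z.2) = 0} :=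
    (isClosed_eq (by fun_prop) continuous_const).measurableSet
  have h : (perMeas.prod perMeas) {z : ℝ × ℝ | Real.sin (z.1 - z.2) = 0} = 0 := by
    rw [Measure.measure_prod_null hm]
    refine Filter.Eventually.of_forall fun x => ?_
    have hc : (Prod.mk x ⁻¹' {z : ℝ × ℝ | Real.sin (z.1 - z.2) = 0}).Countable :=
      countable_sin_eq_zero.preimage (f := fun y : ℝ => x - y) sub_right_injective
    unfold perMeas
    exact hc.measure_zero _
  rw [ae_iff]
  simpa using h

section Recursion

variable {α β γ : ℂ}

lemma integral_reg_eq_zero (α : ℂ) (hβ : β.re = -(1 / 2)) (hγ : γ.re = -(1 / 2)) {ε : ℝ}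
    (hε : ε ≠ 0) (a b : ℤ) :
    ∫ z : ℝ × ℝ, sinPow β z.1 * sinPow γ z.2 * (regPow α ε (z.1 - z.2) *
      Complex.exp (Complex.I * a * z.1) * Complex.exp (Complex.I * b * z.2) *
      ((2 + β + a + α * regRatio ε (z.1 - z.2)) * Complex.exp (2 * Complex.I * z.1) +
        (2 + γ + b + α * regRatio ε (z.1 - z.2)) * Complex.exp (2 * Complex.I * z.2) +
        (β + γ - a - b))) ∂(perMeas.prod perMeas) = 0 := by
  set q : ℝ → ℂ :=
    fun c => ((Real.sin c * Real.cos c / (Real.sin c ^ 2 + ε ^ 2) : ℝ) : ℂ) with hq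
  have hqc : Continuous q := by
    rw [hq]
    exact Complex.continuous_ofReal.comp
      (Continuous.div (by fun_prop) (by fun_prop) (sin_sq_add_ne_zero hε))
  have hRc := continuous_regPow α hε
  have hEc := continuous_expSub
  set X : ℝ → ℝ → ℂ := fun x y =>
    Complex.I * ((2 + β) * Complex.exp (2 * Complex.I * x) + β) *
      (regPow α ε (x - y) * Complex.exp (Complex.I * a * x)) + expSub x *
      ((α * q (x - y) + Complex.I * a) * (regPow α ε (x - y) * Complex.exp (Complex.I * a * x)))
    with hX
  set Y : ℝ → ℝ → ℂ := fun x y =>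
    Complex.I * ((2 + γ) * Complex.exp (2 * Complex.I * y) + γ) *
      (regPow α ε (x - y) * Complex.exp (Complex.I * b * y)) + expSub y *
      ((-(α * q (x - y)) + Complex.I * b) *
        (regPow α ε (x - y) * Complex.exp (Complex.I * b * y))) with hY
  have hXc : Continuous fun z : ℝ × ℝ => X z.1 z.2 := by
    simp only [hX]; fun_prop
  have hYc : Continuous fun z : ℝ × ℝ => Y z.1 z.2 := by
    simp only [hY]; fun_prop
  have hX0 : ∀ y, ∫ x, sinPow β x * X x y ∂perMeas = 0 := by
    intro y
    rw [← integral_perMeas]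
    refine integral_sinPow_mul hβ (h := fun x => regPow α ε (x - y) *
      Complex.exp (Complex.I * a * x)) (fun x => ?_) (by fun_prop)
    refine HasDerivAt.congr_deriv (((hasDerivAt_regPow α hε (x - y)).comp_sub_const x y).mul
      (hasDerivAt_cexp_int a x)) ?_
    simp only [hq]
    ring
  have hY0 : ∀ x, ∫ y, sinPow γ y * Y x y ∂perMeas = 0 := by
    intro x
    rw [← integral_perMeas]
    refine integral_sinPow_mul hγ (h := fun y => regPow α ε (x - y) *
      Complex.exp (Complex.I * b * y)) (fun y => ?_) (by fun_prop)
    refine HasDerivAt.congr_deriv (((hasDerivAt_regPow α hε (x - y)).comp_const_sub x y).mul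
      (hasDerivAt_cexp_int b y)) ?_
    simp only [hq]
    ring
  have hfg : Integrable (fun z : ℝ × ℝ => sinPow β z.1 * sinPow γ z.2) (perMeas.prod perMeas) :=
    (integrable_sinPow hβ).mul_prod (integrable_sinPow hγ)
  have hi1 := integrable_mul_continuous hfg
    (X := fun z => X z.1 z.2 * Complex.exp (Complex.I * b * z.2)) (by fun_prop)
  have hi2 := integrable_mul_continuous hfg
    (X := fun z => Y z.1 z.2 * Complex.exp (Complex.I * a * z.1)) (by fun_prop)
  have h1 : ∫ z : ℝ × ℝ, sinPow β z.1 * sinPow γ z.2 *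
      (X z.1 z.2 * Complex.exp (Complex.I * b * z.2)) ∂(perMeas.prod perMeas) = 0 := by
    rw [integral_prod_symm _ hi1]
    have : ∀ y : ℝ, ∫ x, sinPow β x * sinPow γ y *
        (X x y * Complex.exp (Complex.I * b * y)) ∂perMeas = 0 := by
      intro y
      have e : ∀ x : ℝ, sinPow β x * sinPow γ y * (X x y * Complex.exp (Complex.I * b * y)) =
        sinPow β x * X x y * (sinPow γ y * Complex.exp (Complex.I * b * y)) := fun x => by ring
      simp_rw [e]
      rw [integral_mul_const, hX0, zero_mul]
    simp_rw [this]
    exact integral_zero _ _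
  have h2 : ∫ z : ℝ × ℝ, sinPow β z.1 * sinPow γ z.2 *
      (Y z.1 z.2 * Complex.exp (Complex.I * a * z.1)) ∂(perMeas.prod perMeas) = 0 := by
    rw [integral_prod _ hi2]
    have : ∀ x : ℝ, ∫ y, sinPow β x * sinPow γ y *
        (Y x y * Complex.exp (Complex.I * a * x)) ∂perMeas = 0 := by
      intro x
      have e : ∀ y : ℝ, sinPow β x * sinPow γ y * (Y x y * Complex.exp (Complex.I * a * x)) =
        sinPow γ y * Y x y * (sinPow β x * Complex.exp (Complex.I * a * x)) := fun y => by ring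
      simp_rw [e]
      rw [integral_mul_const, hY0, zero_mul]
    simp_rw [this]
    exact integral_zero _ _
  have h3 := integral_add hi1 hi2
  rw [h1, h2, add_zero] at h3
  have h4 := integral_const_mul (μ := perMeas.prod perMeas) (-Complex.I) fun z : ℝ × ℝ =>
    sinPow β z.1 * sinPow γ z.2 * (X z.1 z.2 * Complex.exp (Complex.I * b * z.2)) +
    sinPow β z.1 * sinPow γ z.2 * (Y z.1 z.2 * Complex.exp (Complex.I * a * z.1))
  rw [h3, mul_zero] at h4
  rw [← h4]
  congr 1
  funext z
  have e := cexp_sub_cexp_mul ε z.1 z.2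
  simp only [hX, hY, hq, expSub]
  linear_combination (sinPow β z.1 * sinPow γ z.2 * regPow α ε (z.1 - z.2) *
    Complex.exp (Complex.I * a * z.1) * Complex.exp (Complex.I * b * z.2) * α * Complex.I) * e +
    (sinPow β z.1 * sinPow γ z.2 * regPow α ε (z.1 - z.2) *
    Complex.exp (Complex.I * a * z.1) * Complex.exp (Complex.I * b * z.2) *
    ((2 + β + a + α * regRatio ε (z.1 - z.2)) * Complex.exp (2 * Complex.I * z.1) +
      (2 + γ + b + α * regRatio ε (z.1 - z.2)) * Complex.exp (2 * Complex.I * z.2) +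
      (β + γ - a - b))) * Complex.I_sq

end Recursion

section Limit

variable {α β γ : ℂ}

/-- The double Fourier coefficient of the three-factor kernel. -/
noncomputable def biHat (α β γ : ℂ) (a b : ℤ) : ℂ :=
  ∫ z : ℝ × ℝ, sinPow α (z.1 - z.2) * sinPow β z.1 * sinPow γ z.2 *
    (Complex.exp (Complex.I * a * z.1) * Complex.exp (Complex.I * b * z.2))
    ∂(perMeas.prod perMeas)

lemma integrable_biKer (hα : α.re = -(1 / 2)) (hβ : β.re = -(1 / 2)) (hγ : γ.re = -(1 / 2)) :
    Integrable (fun z : ℝ × ℝ => sinPow α (z.1 - z.2) * sinPow β z.1 * sinPow γ z.2)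
      (perMeas.prod perMeas) := by
  refine (integrable_sinWt_triple (Or.inr rfl)).mono' ?_ (Filter.Eventually.of_forall fun z => ?_)
  · exact ((((measurable_sinPow α).comp (measurable_fst.sub measurable_snd)).mul
      ((measurable_sinPow β).comp measurable_fst)).mul
      ((measurable_sinPow γ).comp measurable_snd)).aestronglyMeasurable
  · rw [norm_mul, norm_mul, norm_sinPow hα, norm_sinPow hβ, norm_sinPow hγ, neg_one_mul,
      ← sub_eq_add_neg]

lemma integrable_biKer_mul (hα : α.re = -(1 / 2)) (hβ : β.re = -(1 / 2)) (hγ : γ.re = -(1 / 2))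
    (a b : ℤ) :
    Integrable (fun z : ℝ × ℝ => sinPow α (z.1 - z.2) * sinPow β z.1 * sinPow γ z.2 *
      (Complex.exp (Complex.I * a * z.1) * Complex.exp (Complex.I * b * z.2)))
      (perMeas.prod perMeas) :=
  integrable_mul_continuous (integrable_biKer hα hβ hγ) (by fun_prop)

lemma biHat_rec (hα : α.re = -(1 / 2)) (hβ : β.re = -(1 / 2)) (hγ : γ.re = -(1 / 2)) (a b : ℤ) :
    (2 + α + β + a) * biHat α β γ (a + 2) b + (2 + α + γ + b) * biHat α β γ a (b + 2) +
      (β + γ - a - b) * biHat α β γ a b = 0 := by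
  set C : ℝ := (‖2 + β + a‖ + ‖α‖) + (‖2 + γ + b‖ + ‖α‖) + ‖β + γ - a - b‖ with hC
  set G : ℝ → ℝ × ℝ → ℂ := fun ε z => sinPow β z.1 * sinPow γ z.2 * (regPow α ε (z.1 - z.2) *
      Complex.exp (Complex.I * a * z.1) * Complex.exp (Complex.I * b * z.2) *
      ((2 + β + a + α * regRatio ε (z.1 - z.2)) * Complex.exp (2 * Complex.I * z.1) +
        (2 + γ + b + α * regRatio ε (z.1 - z.2)) * Complex.exp (2 * Complex.I * z.2) +
        (β + γ - a - b))) with hG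
  set L : ℝ × ℝ → ℂ := fun z => sinPow β z.1 * sinPow γ z.2 * (sinPow α (z.1 - z.2) *
      Complex.exp (Complex.I * a * z.1) * Complex.exp (Complex.I * b * z.2) *
      ((2 + β + a + α * ((1 : ℝ) : ℂ)) * Complex.exp (2 * Complex.I * z.1) +
        (2 + γ + b + α * ((1 : ℝ) : ℂ)) * Complex.exp (2 * Complex.I * z.2) +
        (β + γ - a - b))) with hL
  have hε : ∀ k : ℕ, (1 / ((k : ℝ) + 1)) ≠ 0 := fun k => by positivity
  have hnorm : ∀ x : ℝ, ‖Complex.exp (2 * Complex.I * x)‖ = 1 := fun x => by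
    have := norm_cexp_int 2 x
    push_cast at this
    rwa [mul_comm Complex.I] at this
  have hlim : Filter.Tendsto (fun k : ℕ => ∫ z, G (1 / ((k : ℝ) + 1)) z ∂(perMeas.prod perMeas))
      Filter.atTop (nhds (∫ z, L z ∂(perMeas.prod perMeas))) := by
    refine tendsto_integral_of_dominated_convergence
      (fun z : ℝ × ℝ => C * (sinWt (1 / 2) (z.1 + -1 * z.2) * sinWt (1 / 2) z.1 *
        sinWt (1 / 2) z.2)) (fun k => ?_) ((integrable_sinWt_triple (Or.inr rfl)).const_mul C)
      (fun k => ?_) ?_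
    · have h1 := continuous_regPow α (hε k)
      have h2 := continuous_regRatio (hε k)
      exact (integrable_mul_continuous ((integrable_sinPow hβ).mul_prod (integrable_sinPow hγ))
        (by fun_prop)).aestronglyMeasurable
    · filter_upwards [ae_sin_sub_ne_zero] with z hz
      have hr : ‖(regRatio (1 / ((k : ℝ) + 1)) (z.1 - z.2) : ℂ)‖ ≤ 1 := by
        rw [Complex.norm_real, Real.norm_of_nonneg (regRatio_mem _ _).1]
        exact (regRatio_mem _ _).2
      have hαr : ‖α * (regRatio (1 / ((k : ℝ) + 1)) (z.1 - z.2) : ℂ)‖ ≤ ‖α‖ := by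
        rw [norm_mul]
        exact mul_le_of_le_one_right (norm_nonneg _) hr
      have hbr : ‖(2 + β + a + α * regRatio (1 / ((k : ℝ) + 1)) (z.1 - z.2)) *
          Complex.exp (2 * Complex.I * z.1) +
          (2 + γ + b + α * regRatio (1 / ((k : ℝ) + 1)) (z.1 - z.2)) *
          Complex.exp (2 * Complex.I * z.2) + (β + γ - a - b)‖ ≤ C := by
        refine (norm_add_le _ _).trans (add_le_add ((norm_add_le _ _).trans (add_le_add ?_ ?_))
          le_rfl)
        · rw [norm_mul, hnorm, mul_one]
          exact (norm_add_le _ _).trans (add_le_add le_rfl hαr)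
        · rw [norm_mul, hnorm, mul_one]
          exact (norm_add_le _ _).trans (add_le_add le_rfl hαr)
      simp only [hG]
      rw [norm_mul, norm_mul, norm_mul, norm_mul, norm_mul, norm_cexp_int, norm_cexp_int,
        norm_sinPow hβ, norm_sinPow hγ, mul_one, mul_one, neg_one_mul, ← sub_eq_add_neg]
      have h1 := mul_le_mul (norm_regPow_le hα (1 / ((k : ℝ) + 1)) hz) hbr (norm_nonneg _)
        (sinWt_pos _ _).le
      have h2 := mul_le_mul_of_nonneg_left h1
        (mul_pos (sinWt_pos (1 / 2) z.1) (sinWt_pos (1 / 2) z.2)).le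
      linarith
    · filter_upwards [ae_sin_sub_ne_zero] with z hz
      have h1 := tendsto_regPow α hz
      have h2 : Filter.Tendsto (fun k : ℕ => (regRatio (1 / ((k : ℝ) + 1)) (z.1 - z.2) : ℂ))
        Filter.atTop (nhds ((1 : ℝ) : ℂ)) :=
        (Complex.continuous_ofReal.tendsto 1).comp (tendsto_regRatio hz)
      exact (((h1.mul_const _).mul_const _).mul ((((h2.const_mul α).const_add _).mul_const _).add
        (((h2.const_mul α).const_add _).mul_const _) |>.add_const _)).const_mul _
  have hzero : ∀ k : ℕ, ∫ z, G (1 / ((k : ℝ) + 1)) z ∂(perMeas.prod perMeas) = 0 :=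
    fun k => integral_reg_eq_zero α hβ hγ (hε k) a b
  simp_rw [hzero] at hlim
  have hL0 := tendsto_nhds_unique hlim tendsto_const_nhds
  rw [← hL0]
  unfold biHat
  have i1 := (integrable_biKer_mul hα hβ hγ (a + 2) b).const_mul (2 + α + β + a)
  have i2 := (integrable_biKer_mul hα hβ hγ a (b + 2)).const_mul (2 + α + γ + b)
  have i3 := (integrable_biKer_mul hα hβ hγ a b).const_mul (β + γ - a - b)
  rw [← integral_const_mul, ← integral_const_mul, ← integral_const_mul, ← integral_add i1 i2]
  refine (integral_add (i1.add i2) i3).symm.trans ?_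
  congr 1
  funext z
  simp only [hL, Pi.add_apply]
  rw [cexp_int_add_two, cexp_int_add_two]
  push_cast
  ring

lemma biHat_neg (hα : α.re = -(1 / 2)) (hβ : β.re = -(1 / 2)) (hγ : γ.re = -(1 / 2)) (a b : ℤ) :
    biHat α β γ (-a) (-b) = biHat α β γ a b := by
  have hneg : ∀ u : ℝ → ℂ, Function.Periodic u (2 * π) →
      ∫ x, u (-x) ∂perMeas = ∫ x, u x ∂perMeas := by
    intro u hu
    rw [← integral_perMeas, ← integral_perMeas]
    have h := intervalIntegral.integral_comp_sub_left (a := 0) (b := 2 * π) u (2 * π)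
    rw [sub_self, sub_zero] at h
    rw [← h]
    congr 1
    funext x
    rw [sub_eq_neg_add, hu]
  unfold biHat
  rw [integral_prod _ (integrable_biKer_mul hα hβ hγ _ _),
    integral_prod _ (integrable_biKer_mul hα hβ hγ _ _)]
  set Φ : ℝ → ℝ → ℂ := fun x y => sinPow α (x - y) * sinPow β x * sinPow γ y *
    (Complex.exp (Complex.I * a * x) * Complex.exp (Complex.I * b * y)) with hΦ
  have hy : ∀ x, Function.Periodic (Φ x) (2 * π) := by
    intro x y
    have h1 := cexp_int_periodic b y
    have h2 : sinPow α (x - (y + 2 * π)) = sinPow α (x - y) := by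
      rw [← sub_sub, ← sinPow_periodic α (x - y - 2 * π), sub_add_cancel]
    beta_reduce at h1
    simp only [hΦ]
    rw [h1, h2, sinPow_periodic]
  have hx : Function.Periodic (fun x => ∫ y, Φ x y ∂perMeas) (2 * π) := by
    intro x
    beta_reduce
    congr 1
    funext y
    have h1 := cexp_int_periodic a x
    beta_reduce at h1
    simp only [hΦ]
    rw [h1, sinPow_periodic, add_sub_right_comm, sinPow_periodic]
  have key : ∫ x, ∫ y, Φ (-x) (-y) ∂perMeas ∂perMeas = ∫ x, ∫ y, Φ x y ∂perMeas ∂perMeas := by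
    rw [← hneg _ hx]
    congr 1
    funext x
    exact hneg _ (hy (-x))
  refine Eq.trans ?_ key
  congr 1
  funext x
  congr 1
  funext y
  simp only [hΦ]
  rw [sinPow_neg, sinPow_neg, ← neg_add', ← sub_neg_eq_add, sinPow_neg]
  push_cast
  ring_nf

lemma hat_triKer_eq_biHat (hα : α.re = -(1 / 2)) (hβ : β.re = -(1 / 2)) (hγ : γ.re = -(1 / 2))
    (n : ℤ) : hat (triKer α β γ) n = biHat α β γ n (-n) := by
  have hexp : Continuous fun z : ℝ × ℝ => Complex.exp (Complex.I * n * z.1) :=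
    (continuous_cexp_int n).comp continuous_fst
  have hint : Integrable (fun z : ℝ × ℝ => sinPow α z.1 * (sinPow β (z.2 + z.1) * sinPow γ z.2) *
      Complex.exp (Complex.I * n * z.1)) (perMeas.prod perMeas) :=
    integrable_mul_continuous (integrable_triKer_prod hα hβ hγ) hexp
  unfold biHat
  rw [integral_prod_symm _ (integrable_biKer_mul hα hβ hγ _ _)]
  calc hat (triKer α β γ) n
      = ∫ c, ∫ y, sinPow α c * (sinPow β (y + c) * sinPow γ y) *
          Complex.exp (Complex.I * n * c) ∂perMeas ∂perMeas := by
        rw [hat_eq]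
        congr 1
        funext c
        rw [integral_mul_const, integral_const_mul]; rfl
    _ = ∫ y, ∫ c, sinPow α c * (sinPow β (y + c) * sinPow γ y) *
          Complex.exp (Complex.I * n * c) ∂perMeas ∂perMeas := integral_integral_swap hint
    _ = _ := by
        congr 1
        funext y
        have hper : Function.Periodic (fun x : ℝ => sinPow α (x - y) * sinPow β x * sinPow γ y *
            (Complex.exp (Complex.I * n * x) * Complex.exp (Complex.I * (-n : ℤ) * y)))
            (2 * π) := by
          intro x
          have h1 := cexp_int_periodic n x
          beta_reduce at h1 ⊢
          rw [h1, sinPow_periodic, add_sub_right_comm, sinPow_periodic]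
        refine Eq.trans ?_ (integral_perMeas_add hper y)
        congr 1
        funext c
        have : Complex.exp (Complex.I * n * c) =
            Complex.exp (Complex.I * n * ((c + y : ℝ) : ℂ)) *
              Complex.exp (Complex.I * ((-n : ℤ) : ℂ) * y) := by
          rw [← Complex.exp_add]; push_cast; ring_nf
        rw [this, add_sub_cancel_right, add_comm y c]
        ring

end Limit

lemma hat_triKer_neg {α β γ : ℂ} (hα : α.re = -(1 / 2)) (hβ : β.re = -(1 / 2))
    (hγ : γ.re = -(1 / 2)) (n : ℤ) : hat (triKer α β γ) (-n) = hat (triKer α β γ) n := by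
  rw [hat_triKer_eq_biHat hα hβ hγ, hat_triKer_eq_biHat hα hβ hγ, biHat_neg hα hβ hγ]

/-- The three-term recursion for the Fourier coefficients of the model kernel. -/
lemma hat_triKer_rec {α β γ τ lam : ℂ} (hα : α.re = -(1 / 2)) (hβ : β.re = -(1 / 2))
    (hγ : γ.re = -(1 / 2)) (hαβ : α + β = -1 - τ) (hαγ : α + γ = -1 + τ) (hβγ : β + γ = -1 - lam)
    (n : ℤ) :
    ((n + 1) ^ 2 - τ ^ 2) * (hat (triKer α β γ) (n + 2) - hat (triKer α β γ) n) -
      ((n - 1) ^ 2 - τ ^ 2) * (hat (triKer α β γ) n - hat (triKer α β γ) (n - 2)) =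
      (lam ^ 2 - 1) * hat (triKer α β γ) n := by
  simp only [hat_triKer_eq_biHat hα hβ hγ]
  have r1 := biHat_rec hα hβ hγ n (-n - 2)
  have r2 := biHat_rec hα hβ hγ (n - 2) (-n)
  have r3 := biHat_rec hα hβ hγ (-n) n
  have e1 : biHat α β γ (-n + 2) n = biHat α β γ (n - 2) (-n) := by
    rw [← biHat_neg hα hβ hγ]; congr 1; ring
  have e2 : biHat α β γ (-n) (n + 2) = biHat α β γ n (-n - 2) := by
    rw [← biHat_neg hα hβ hγ]; congr 1 <;> ring
  have e3 : biHat α β γ (-n) n = biHat α β γ n (-n) := by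
    rw [← biHat_neg hα hβ hγ, neg_neg]
  rw [e1, e2, e3] at r3
  rw [sub_add_cancel] at r1 r2
  rw [show -(n + 2) = -n - 2 by ring, show -(n - 2) = -n + 2 by ring]
  push_cast at r1 r2 r3 ⊢
  set F₀ := biHat α β γ n (-n)
  set F₁ := biHat α β γ (n + 2) (-n - 2)
  set F₂ := biHat α β γ (n - 2) (-n + 2)
  set U := biHat α β γ n (-n - 2)
  set V := biHat α β γ (n - 2) (-n)
  have q1 : (n + 1 - τ) * (F₁ - F₀) = (lam - 1) * U := by
    linear_combination r1 - F₁ * hαβ - F₀ * hαγ - U * hβγ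
  have q2 : (n - 1 - τ) * (F₀ - F₂) = (lam - 1) * V := by
    linear_combination r2 - F₀ * hαβ - F₂ * hαγ - V * hβγ
  have q3 : (n + 1 + τ) * U - (n - 1 + τ) * V = (lam + 1) * F₀ := by
    linear_combination r3 - V * hαβ - U * hαγ - F₀ * hβγ
  linear_combination (n + 1 + τ) * q1 - (n - 1 + τ) * q2 + (lam - 1) * q3

section Decay

variable {F : ℤ → ℂ} {t s : ℝ}

lemma isSol_of_rec (L : ℂ →ₗ[ℝ] ℝ)
    (hrec : ∀ n : ℤ, (((n + 1 : ℝ) ^ 2 + t ^ 2 : ℝ) : ℂ) * (F (n + 2) - F n) -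
      (((n - 1 : ℝ) ^ 2 + t ^ 2 : ℝ) : ℂ) * (F n - F (n - 2)) = ((-(1 + s ^ 2) : ℝ) : ℂ) * F n)
    (hsym : ∀ n, F (-n) = F n) :
    IsSol t s (fun k : ℕ => (2 * (k : ℝ) + 1) ^ 2 + t ^ 2) (fun k : ℕ => L (F (2 * k))) := by
  have hL : ∀ n : ℤ, ((n + 1 : ℝ) ^ 2 + t ^ 2) * (L (F (n + 2)) - L (F n)) -
      ((n - 1 : ℝ) ^ 2 + t ^ 2) * (L (F n) - L (F (n - 2))) = -(1 + s ^ 2) * L (F n) := by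
    intro n
    have h := congrArg L (hrec n)
    simpa only [← Complex.real_smul, map_sub, map_smul, smul_eq_mul] using h
  refine ⟨fun k => rfl, ?_, fun k => ?_⟩
  · have h := hL 0
    rw [zero_sub, hsym 2] at h
    norm_num at h ⊢
    linarith
  · have h := hL (2 * k + 2)
    rw [add_sub_cancel_right] at h
    push_cast at h ⊢
    rw [show (2 : ℤ) * (k + 2) = 2 * k + 2 + 2 by ring, show (2 : ℤ) * (k + 1) = 2 * k + 2 by ring]
    rw [← h]
    ring

lemma sq_norm_add_le
    (hrec : ∀ n : ℤ, (((n + 1 : ℝ) ^ 2 + t ^ 2 : ℝ) : ℂ) * (F (n + 2) - F n) -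
      (((n - 1 : ℝ) ^ 2 + t ^ 2 : ℝ) : ℂ) * (F n - F (n - 2)) = ((-(1 + s ^ 2) : ℝ) : ℂ) * F n)
    (hsym : ∀ n, F (-n) = F n) (hs : 100 * (1 + |t|) ≤ s) {B M : ℝ} (hB : ∀ n, ‖F n‖ ≤ B)
    (hM : ∀ S : Finset ℤ, ∑ m ∈ S, ‖F (m + 4) - 2 * F (m + 2) + F m‖ ^ 2 ≤ M / s) (k : ℕ) :
    (8 * (k : ℝ) ≤ s → ‖F (2 * k) + F (2 * k + 2)‖ ^ 2 ≤ 2 * (8 * 24 ^ 3 * B ^ 2 * (1 / s ^ 3))) ∧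
    (s ≤ 8 * k → ‖F (2 * k) + F (2 * k + 2)‖ ^ 2 * (s * (2 * k + 1)) ≤
      2 * (3200 * M * (8000 * Real.exp (4 * (1 + t ^ 2)) + 2048000 * Real.exp 320))) := by
  have hsplit : ‖F (2 * k) + F (2 * k + 2)‖ ^ 2 =
      (Complex.reLm (F (2 * k)) + Complex.reLm (F (2 * (k + 1 : ℕ)))) ^ 2 +
      (Complex.imLm (F (2 * k)) + Complex.imLm (F (2 * (k + 1 : ℕ)))) ^ 2 := by
    rw [← Complex.normSq_eq_norm_sq, Complex.normSq_apply]
    push_cast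
    rw [mul_add, mul_one]
    simp only [Complex.reLm_coe, Complex.imLm_coe, Complex.add_re, Complex.add_im]
    ring
  have hbd : ∀ L : ℂ →ₗ[ℝ] ℝ, (∀ z, |L z| ≤ ‖z‖) → ∀ N : ℕ,
      ∑ k ∈ Finset.range N, (L (F (2 * (k + 2 : ℕ))) - 2 * L (F (2 * (k + 1 : ℕ))) +
        L (F (2 * k))) ^ 2 ≤ M / s := by
    intro L hL N
    refine le_trans ?_ (hM ((Finset.range N).map
      ⟨fun k : ℕ => (2 * k : ℤ), fun a b h => by simpa using h⟩))
    rw [Finset.sum_map]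
    refine Finset.sum_le_sum fun j _ => ?_
    have h := hL (F (2 * j + 4) - 2 * F (2 * j + 2) + F (2 * j))
    have e : L (F (2 * j + 4) - 2 * F (2 * j + 2) + F (2 * j)) =
        L (F (2 * (j + 2 : ℕ))) - 2 * L (F (2 * (j + 1 : ℕ))) + L (F (2 * j)) := by
      rw [show (2 : ℂ) * F (2 * j + 2) = (2 : ℝ) • F (2 * j + 2) by
        rw [Complex.real_smul]; push_cast; rfl]
      rw [map_add, map_sub, map_smul, smul_eq_mul]
      push_cast
      ring_nf
    rw [← e, ← sq_abs]
    exact pow_le_pow_left₀ (abs_nonneg _) h 2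
  have hre := isSol_of_rec Complex.reLm hrec hsym
  have him := isSol_of_rec Complex.imLm hrec hsym
  constructor
  · intro hk
    have h1 := hre.sq_add_le_of_small hs
      (fun j => (Complex.abs_re_le_norm _).trans (hB (2 * j))) k hk
    have h2 := him.sq_add_le_of_small hs
      (fun j => (Complex.abs_im_le_norm _).trans (hB (2 * j))) k hk
    rw [hsplit]
    linarith
  · intro hk
    have h1 := hre.sq_add_le_of_large_index hs (hbd _ Complex.abs_re_le_norm) k hk
    have h2 := him.sq_add_le_of_large_index hs (hbd _ Complex.abs_im_le_norm) k hk
    rw [hsplit]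
    linarith

lemma exists_nat_norm_add_eq (hsym : ∀ n, F (-n) = F n) {n : ℤ} (hn : Even n) :
    ∃ k : ℕ, ‖F n + F (n + 2)‖ = ‖F (2 * k) + F (2 * k + 2)‖ ∧
      2 * (k : ℝ) ≤ |(n : ℝ)| ∧ |(n : ℝ)| ≤ 2 * k + 2 := by
  obtain ⟨j, rfl⟩ := hn
  rcases le_or_gt 0 j with hj | hj
  · obtain ⟨k, rfl⟩ := Int.eq_ofNat_of_zero_le hj
    refine ⟨k, by rw [← two_mul], ?_, ?_⟩ <;>
    · push_cast
      rw [abs_of_nonneg (by positivity)]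
      linarith
  · obtain ⟨k, hk⟩ := Int.eq_ofNat_of_zero_le (show 0 ≤ -j - 1 by omega)
    obtain rfl : j = -(k : ℤ) - 1 := by omega
    refine ⟨k, ?_, ?_, ?_⟩
    · rw [← hsym (2 * k), ← hsym (2 * k + 2), add_comm]
      congr 3 <;> ring
    all_goals
      push_cast
      rw [abs_of_nonpos (by have : (0 : ℝ) ≤ k := k.cast_nonneg; linarith)]
      linarith

end Decay

lemma sum_sq_second_diff_div_le {α β γ : ℂ} (hα : α.re = -(1 / 2)) (hβ : β.re = -(1 / 2))
    (hγ : γ.re = -(1 / 2)) {s : ℝ} (hs : 4 ≤ s) (hβs : s / 4 ≤ |β.im|) (hγs : s / 4 ≤ |γ.im|)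
    (S : Finset ℤ) :
    ∑ m ∈ S, ‖hat (triKer α β γ) (m + 4) - 2 * hat (triKer α β γ) (m + 2) +
      hat (triKer α β γ) m‖ ^ 2 ≤ 2 ^ 18 * π ^ 4 / s := by
  have key : ∀ {σ : ℂ}, σ.re = -(1 / 2) → s / 4 ≤ |σ.im| → ∀ m,
      ‖hat (sinPow σ) m‖ ^ 2 ≤ 256 * π ^ 2 / (s / 4) := by
    intro σ hσ hσs m
    refine (sq_norm_hat_sinPow_le hσ (by linarith) m).trans ?_
    gcongr
  refine (sum_sq_second_diff_le hα hβ hγ (key hβ hβs) (key hγ hγs) S).trans (le_of_eq ?_)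
  field_simp
  ring

lemma norm_Ffun_le {τ lam : ℂ} (hτ : τ.re = 0) (hlam : lam.re = 0) (n : ℤ) :
    ‖Ffun τ (-τ) lam n (fun c => 1 + Complex.exp (2 * Complex.I * (c : ℂ)))‖ ≤
      ‖hat (triKer ((-τ - -τ + lam - 1) / 2) ((-τ + -τ - lam - 1) / 2) ((τ - -τ - lam - 1) / 2)) n +
      hat (triKer ((-τ - -τ + lam - 1) / 2) ((-τ + -τ - lam - 1) / 2)
        ((τ - -τ - lam - 1) / 2)) (n + 2)‖ := by
  rw [Ffun_eq hτ (by rw [Complex.neg_re, hτ, neg_zero]) hlam, norm_mul]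
  refine mul_le_of_le_one_left (norm_nonneg _) ?_
  rw [norm_div, norm_one, norm_mul, Complex.norm_real, Complex.norm_ofNat,
    Real.norm_of_nonneg Real.pi_pos.le]
  exact div_le_one_of_le₀ (by linarith [Real.pi_gt_three]) (by positivity)

/-- Decay of the sums of consecutive even Fourier coefficients of the model kernel. -/
lemma exists_bound_hat_triKer {τ : ℂ} (hτ : τ.re = 0) {s : ℝ} (hs : 100 * (1 + ‖τ‖) ≤ |s|) {n : ℤ}
    (hn : Even n) {J : ℝ → ℂ}
    (hJ : J = triKer ((-τ - -τ + Complex.I * s - 1) / 2) ((-τ + -τ - Complex.I * s - 1) / 2)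
      ((τ - -τ - Complex.I * s - 1) / 2)) :
    ∃ k : ℕ, 2 * (k : ℝ) ≤ |(n : ℝ)| ∧ |(n : ℝ)| ≤ 2 * k + 2 ∧
      (8 * (k : ℝ) ≤ |s| →
        ‖hat J n + hat J (n + 2)‖ ^ 2 ≤ 2 * (8 * 24 ^ 3 * triBound ^ 2 * (1 / |s| ^ 3))) ∧
      (|s| ≤ 8 * k → ‖hat J n + hat J (n + 2)‖ ^ 2 * (|s| * (2 * k + 1)) ≤
        2 * (3200 * (2 ^ 18 * π ^ 4) *
          (8000 * Real.exp (4 * (1 + τ.im ^ 2)) + 2048000 * Real.exp 320))) := by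
  have hα : ((-τ - -τ + Complex.I * s - 1) / 2).re = -(1 / 2) := by simp; ring
  have hβ : ((-τ + -τ - Complex.I * s - 1) / 2).re = -(1 / 2) := by simp [hτ]; ring
  have hγ : ((τ - -τ - Complex.I * s - 1) / 2).re = -(1 / 2) := by simp [hτ]; ring
  have hβi : ((-τ + -τ - Complex.I * s - 1) / 2).im = -(τ.im + s / 2) := by simp; ring
  have hγi : ((τ - -τ - Complex.I * s - 1) / 2).im = τ.im - s / 2 := by simp; ring
  have hτe : τ = τ.im * Complex.I := by
    apply Complex.ext <;> simp [hτ]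
  have hnorm : ‖τ‖ = |τ.im| := by
    rw [hτe, norm_mul, Complex.norm_I, mul_one, Complex.norm_real, Real.norm_eq_abs]
    simp
  have hsym := hat_triKer_neg hα hβ hγ
  have hrec := hat_triKer_rec (τ := τ) (lam := Complex.I * s) hα hβ hγ (by ring) (by ring)
    (by ring)
  have hB := norm_hat_triKer_le hα hβ hγ
  have hhalf : |s / 2| = |s| / 2 := by rw [abs_div, abs_two]
  rw [hnorm] at hs
  have ht := abs_nonneg τ.im
  have hM := sum_sq_second_diff_div_le hα hβ hγ (s := |s|) (by linarith)
    (by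
      rw [hβi, abs_neg]
      have := abs_sub_abs_le_abs_sub (s / 2) (-τ.im)
      rw [abs_neg, sub_neg_eq_add, add_comm (s / 2)] at this
      linarith)
    (by
      rw [hγi]
      have := abs_sub_abs_le_abs_sub (s / 2) τ.im
      rw [abs_sub_comm (s / 2)] at this
      linarith)
  rw [← hJ] at hsym hrec hB hM
  obtain ⟨k, hk, hk1, hk2⟩ := exists_nat_norm_add_eq hsym hn
  have h := sq_norm_add_le (t := τ.im) (fun m => by
    rw [sq_abs]
    have hm := hrec m
    have e1 : τ ^ 2 = -(τ.im : ℂ) ^ 2 := by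
      rw [hτe, mul_pow, Complex.I_sq]; simp
    rw [mul_pow, Complex.I_sq, e1] at hm
    push_cast
    linear_combination hm) hsym hs hB hM k
  rw [← hk] at h
  exact ⟨k, hk1, hk2, h⟩

/-- Spectral bounds `(II₁)`, `(II₂)` for the test vector `φ̃(c) = 1 + e^{2ic}`
(case `τ' = -τ`, `𝒮 = 4|τ| + 1`):
if `𝒮 ≤ |λ| ≤ 4|n|` then `|F_{λ,n}(φ̃)|² ≤ C(1+|n|)^{-1}|λ|^{-1} + C|λ|^{-3}`, and
if `|λ| ≥ max(𝒮, 4|n|)` then `|F_{λ,n}(φ̃)|² ≤ C|λ|^{-3}`. -/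
theorem stmt_15 (τ : ℂ) (hτ : τ.re = 0) :
    ∃ C : ℝ, 0 < C ∧
      ∀ n : ℤ, Even n → ∀ s : ℝ,
        ((4 * ‖τ‖ + 1 ≤ |s| ∧ |s| ≤ 4 * |(n : ℝ)| →
          ‖Ffun τ (-τ) (Complex.I * (s : ℂ)) n
              (fun c => 1 + Complex.exp (2 * Complex.I * (c : ℂ)))‖ ^ 2 ≤
            C * (1 + |(n : ℝ)|)⁻¹ * |s|⁻¹ + C * |s| ^ (-3 : ℝ)) ∧
        (max (4 * ‖τ‖ + 1) (4 * |(n : ℝ)|) ≤ |s| →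
          ‖Ffun τ (-τ) (Complex.I * (s : ℂ)) n
              (fun c => 1 + Complex.exp (2 * Complex.I * (c : ℂ)))‖ ^ 2 ≤
            C * |s| ^ (-3 : ℝ))) := by
  set C₀ : ℝ := 4 * triBound ^ 2 * (100 * (1 + ‖τ‖)) ^ 3 with hC₀
  set C₁ : ℝ := 2 * (8 * 24 ^ 3 * triBound ^ 2) with hC₁
  set C₂ : ℝ := 2 * (3200 * (2 ^ 18 * π ^ 4) *
    (8000 * Real.exp (4 * (1 + τ.im ^ 2)) + 2048000 * Real.exp 320)) with hC₂
  have hp₀ : 0 ≤ C₀ := by positivity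
  have hp₁ : 0 ≤ C₁ := by positivity
  have hp₂ : 0 ≤ C₂ := by positivity
  refine ⟨C₀ + C₁ + 3 * C₂ + 1, by positivity, fun n hn s => ?_⟩
  set C := C₀ + C₁ + 3 * C₂ + 1
  set J := triKer ((-τ - -τ + Complex.I * s - 1) / 2) ((-τ + -τ - Complex.I * s - 1) / 2)
      ((τ - -τ - Complex.I * s - 1) / 2) with hJ
  have hF := pow_le_pow_left₀ (norm_nonneg _)
    (norm_Ffun_le hτ (lam := Complex.I * s) (by simp) n) 2
  rw [← hJ] at hF
  have hτ0 := norm_nonneg τ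
  have hpow : 0 < |s| → |s| ^ (-3 : ℝ) = 1 / |s| ^ 3 := fun h => by
    rw [Real.rpow_neg h.le, one_div]
    norm_cast
  have hsmall : 0 < |s| → ‖hat J n + hat J (n + 2)‖ ^ 2 ≤ (C₀ + C₁) * (1 / |s| ^ 3) →
      ‖hat J n + hat J (n + 2)‖ ^ 2 ≤ C * |s| ^ (-3 : ℝ) := fun h h1 => by
    rw [hpow h]
    exact h1.trans (mul_le_mul_of_nonneg_right (by linarith) (by positivity))
  have hlow : 0 < |s| → |s| < 100 * (1 + ‖τ‖) →
      ‖hat J n + hat J (n + 2)‖ ^ 2 ≤ (C₀ + C₁) * (1 / |s| ^ 3) := fun h0 h => by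
    have hb := norm_hat_triKer_le (α := (-τ - -τ + Complex.I * s - 1) / 2)
      (β := (-τ + -τ - Complex.I * s - 1) / 2) (γ := (τ - -τ - Complex.I * s - 1) / 2)
      (by simp; ring) (by simp [hτ]; ring) (by simp [hτ]; ring)
    rw [← hJ] at hb
    have h1 : ‖hat J n + hat J (n + 2)‖ ≤ 2 * triBound :=
      (norm_add_le _ _).trans (by linarith [hb n, hb (n + 2)])
    have h2 := pow_le_pow_left₀ (norm_nonneg _) h1 2
    have h3 := pow_le_pow_left₀ h0.le h.le 3
    rw [mul_one_div, le_div_iff₀ (by positivity)]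
    calc ‖hat J n + hat J (n + 2)‖ ^ 2 * |s| ^ 3
        ≤ (2 * triBound) ^ 2 * (100 * (1 + ‖τ‖)) ^ 3 := by gcongr
      _ = C₀ := by rw [hC₀]; ring
      _ ≤ C₀ + C₁ := by linarith
  constructor
  · rintro ⟨h1, -⟩
    have h0 : 0 < |s| := by linarith
    have hnn : 0 ≤ C * (1 + |(n : ℝ)|)⁻¹ * |s|⁻¹ := by positivity
    have hnn' : 0 ≤ C * |s| ^ (-3 : ℝ) := by positivity
    refine hF.trans ?_
    rcases lt_or_ge |s| (100 * (1 + ‖τ‖)) with h | h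
    · linarith [hsmall h0 (hlow h0 h)]
    · obtain ⟨k, -, hk2, hk3, hk4⟩ := exists_bound_hat_triKer hτ h hn hJ
      rcases le_total (8 * (k : ℝ)) |s| with h8 | h8
      · have h5 := (hk3 h8).trans (b := 2 * (8 * 24 ^ 3 * triBound ^ 2 * (1 / |s| ^ 3)))
          (c := (C₀ + C₁) * (1 / |s| ^ 3)) (by
            rw [← mul_assoc, ← hC₁]
            exact mul_le_mul_of_nonneg_right (by linarith) (by positivity))
        linarith [hsmall h0 h5]
      · have h5 := hk4 h8
        rw [← hC₂] at h5
        have h6 : ‖hat J n + hat J (n + 2)‖ ^ 2 ≤ C * (1 + |(n : ℝ)|)⁻¹ * |s|⁻¹ := by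
          rw [mul_assoc, ← mul_inv, ← div_eq_mul_inv, le_div_iff₀ (by positivity)]
          calc ‖hat J n + hat J (n + 2)‖ ^ 2 * ((1 + |(n : ℝ)|) * |s|)
              ≤ ‖hat J n + hat J (n + 2)‖ ^ 2 * ((3 * (2 * k + 1)) * |s|) := by
                gcongr
                have : (0 : ℝ) ≤ k := k.cast_nonneg
                linarith
            _ = 3 * (‖hat J n + hat J (n + 2)‖ ^ 2 * (|s| * (2 * k + 1))) := by ring
            _ ≤ 3 * C₂ := by linarith
            _ ≤ C := by linarith
        linarith
  · intro h
    have h1 := (le_max_left _ _).trans h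
    have h2 := (le_max_right _ _).trans h
    have h0 : 0 < |s| := by linarith
    refine hF.trans (hsmall h0 ?_)
    rcases lt_or_ge |s| (100 * (1 + ‖τ‖)) with h3 | h3
    · exact hlow h0 h3
    · obtain ⟨k, hk1, -, hk3, -⟩ := exists_bound_hat_triKer hτ h3 hn hJ
      refine (hk3 (by linarith)).trans ?_
      rw [← mul_assoc, ← hC₁]
      exact mul_le_mul_of_nonneg_right (by linarith) (by positivity)
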